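/- arXiv:1601.06269 — 5 statements merged into one kernel-verified Lean document; each statement's English description precedes it below -/
import Mathlib

section
/- Let x ∈ ℂ^n be a unit vector such that the rank-one matrix |x⟩⟨x| (the n×n matrix with (i,j) entry x_i·conj(x_j)) is not diagonal, and let δ be any incoherent state. Then the Hermitian matrix |x⟩⟨x| − δ has exactly one positive eigenvalue λ_1, the eigenspace for λ_1 is one-dimensional, and ‖|x⟩⟨x| − δ‖_tr = 2·‖|x⟩⟨x| − δ‖ = 2·λ_1. -/
open Matrix BigOperators
open scoped ComplexOrder

/-- The trace norm of a Hermitian matrix: the sum of the absolute values of its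
eigenvalues (junk value `0` for non-Hermitian matrices). -/
noncomputable def traceNorm {m : Type*} [Fintype m] [DecidableEq m] (A : Matrix m m ℂ) : ℝ :=
  if h : A.IsHermitian then ∑ i, |h.eigenvalues i| else 0

/-- The operator norm of a Hermitian matrix: the maximum of the absolute values of its
eigenvalues (junk value `0` for non-Hermitian matrices). -/
noncomputable def opNorm {m : Type*} [Fintype m] [DecidableEq m] (A : Matrix m m ℂ) : ℝ :=
  if h : A.IsHermitian then ⨆ i, |h.eigenvalues i| else 0

/-- A density matrix: positive semidefinite with trace 1. -/
def IsDensity {m : Type*} [Fintype m] (A : Matrix m m ℂ) : Prop :=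
  A.PosSemidef ∧ A.trace = 1

/-- An incoherent state: a diagonal density matrix. -/
def IsIncoherent {m : Type*} [Fintype m] [DecidableEq m] (A : Matrix m m ℂ) : Prop :=
  IsDensity A ∧ ∀ i j, i ≠ j → A i j = 0

/-- `|x⟩⟨x|`, the rank-one matrix with `(i,j)` entry `x i * conj (x j)`. -/
def outer {m : Type*} (x : m → ℂ) : Matrix m m ℂ :=
  Matrix.of fun i j => x i * star (x j)

namespace Matrix

variable {m : Type*} [Fintype m]

/-- On the orthogonal complement of `x`, the quadratic form of `|x⟩⟨x| - δ` is nonpositive. -/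
theorem re_dotProduct_outer_sub_mulVec_nonpos {x v : m → ℂ} {δ : Matrix m m ℂ}
    (hδ : δ.PosSemidef) (hv : star x ⬝ᵥ v = 0) :
    (star v ⬝ᵥ (outer x - δ) *ᵥ v).re ≤ 0 := by
  have houter : outer x *ᵥ v = 0 := by
    change vecMulVec x (star x) *ᵥ v = 0
    rw [vecMulVec_mulVec, hv]
    simp
  have hre := (Complex.le_def.mp (hδ.dotProduct_mulVec_nonneg v)).1
  rw [sub_mulVec, houter, zero_sub, dotProduct_neg, Complex.neg_re]
  simpa using hre

theorem eq_zero_of_outer_sub_mulVec_eq_smul {x v : m → ℂ} {δ : Matrix m m ℂ}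
    (hδ : δ.PosSemidef) {μ : ℝ} (hμ : 0 < μ) (hAv : (outer x - δ) *ᵥ v = (μ : ℂ) • v)
    (hv : star x ⬝ᵥ v = 0) : v = 0 := by
  have hnonpos := re_dotProduct_outer_sub_mulVec_nonpos hδ hv
  have hnn := Complex.le_def.mp (dotProduct_star_self_nonneg v)
  rw [hAv, dotProduct_smul, smul_eq_mul, Complex.re_ofReal_mul] at hnonpos
  have hre : (star v ⬝ᵥ v).re = 0 :=
    le_antisymm (nonpos_of_mul_nonpos_right hnonpos hμ) (by simpa using hnn.1)
  exact dotProduct_star_self_eq_zero.mp <|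
    Complex.ext hre (by simpa using hnn.2.symm)

theorem trace_outer (x : m → ℂ) : (outer x).trace = ((∑ i, ‖x i‖ ^ 2 : ℝ) : ℂ) := by
  simp [trace, outer, Complex.mul_conj, Complex.normSq_eq_norm_sq]

variable [DecidableEq m]

theorem IsHermitian.star_eigenvectorBasis_dotProduct {A : Matrix m m ℂ} (hA : A.IsHermitian)
    (i j : m) :
    star (⇑(hA.eigenvectorBasis i)) ⬝ᵥ ⇑(hA.eigenvectorBasis j) = if i = j then 1 else 0 := by
  rw [← orthonormal_iff_ite.mp hA.eigenvectorBasis.orthonormal i j,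
    EuclideanSpace.inner_eq_star_dotProduct, dotProduct_comm]

/-- `|x⟩⟨x| - δ` has at most one positive eigenvalue, counted with multiplicity. -/
theorem eq_of_eigenvalues_outer_sub_pos {x : m → ℂ} {δ : Matrix m m ℂ}
    (hδ : δ.PosSemidef) (h : (outer x - δ).IsHermitian) {i j : m}
    (hi : 0 < h.eigenvalues i) (hj : 0 < h.eigenvalues j) : i = j := by
  by_contra hij
  set u : m → ℂ := ⇑(h.eigenvectorBasis i)
  set w : m → ℂ := ⇑(h.eigenvectorBasis j)
  have hAu : (outer x - δ) *ᵥ u = (h.eigenvalues i : ℂ) • u :=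
    h.mulVec_eigenvectorBasis i
  have hAw : (outer x - δ) *ᵥ w = (h.eigenvalues j : ℂ) • w :=
    h.mulVec_eigenvectorBasis j
  have huu : star u ⬝ᵥ u = 1 := by simpa using h.star_eigenvectorBasis_dotProduct i i
  have hww : star w ⬝ᵥ w = 1 := by simpa using h.star_eigenvectorBasis_dotProduct j j
  have huw : star u ⬝ᵥ w = 0 := by simpa [hij] using h.star_eigenvectorBasis_dotProduct i j
  have hwu : star w ⬝ᵥ u = 0 := by
    simpa [Ne.symm hij] using h.star_eigenvectorBasis_dotProduct j i
  set a := star x ⬝ᵥ u with ha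
  set b := star x ⬝ᵥ w with hb
  have hb0 : b ≠ 0 := fun hb0 => by
    simp [eq_zero_of_outer_sub_mulVec_eq_smul hδ hj hAw hb0] at hww
  have hform := re_dotProduct_outer_sub_mulVec_nonpos (v := b • u - a • w) hδ (by
    rw [dotProduct_sub, dotProduct_smul, dotProduct_smul, ← ha, ← hb, smul_eq_mul, smul_eq_mul,
      mul_comm, sub_self])
  have hval : star (b • u - a • w) ⬝ᵥ (outer x - δ) *ᵥ (b • u - a • w) =
      ((h.eigenvalues i * Complex.normSq b + h.eigenvalues j * Complex.normSq a : ℝ) : ℂ) := by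
    simp only [mulVec_sub, mulVec_smul, hAu, hAw, star_sub, star_smul, sub_dotProduct,
      dotProduct_sub, smul_dotProduct, dotProduct_smul, huu, hww, huw, hwu, smul_eq_mul]
    push_cast
    simp only [Complex.normSq_eq_conj_mul_self, Complex.star_def]
    ring
  rw [hval, Complex.ofReal_re] at hform
  have := mul_pos hi (Complex.normSq_pos.mpr hb0)
  have := mul_nonneg hj.le (Complex.normSq_nonneg a)
  linarith

theorem finrank_eigenspace_outer_sub_le_one {x : m → ℂ} {δ : Matrix m m ℂ}
    (hδ : δ.PosSemidef) {μ : ℝ} (hμ : 0 < μ) :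
    Module.finrank ℂ (Module.End.eigenspace (toLin' (outer x - δ)) (μ : ℂ)) ≤ 1 := by
  let φ : (m → ℂ) →ₗ[ℂ] ℂ := dotProductBilin ℂ ℂ (star x)
  have hinj : Function.Injective
      (φ.domRestrict (Module.End.eigenspace (toLin' (outer x - δ)) (μ : ℂ))) := by
    rw [← LinearMap.ker_eq_bot, LinearMap.ker_eq_bot']
    rintro ⟨v, hv⟩ hφ
    rw [Module.End.mem_eigenspace_iff, toLin'_apply] at hv
    exact Subtype.ext (eq_zero_of_outer_sub_mulVec_eq_smul hδ hμ hv hφ)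
  simpa using LinearMap.finrank_le_finrank_of_injective hinj

end Matrix

/-- if `|x⟩⟨x|` is not diagonal and `δ` is incoherent, then `|x⟩⟨x| - δ` has
exactly one positive eigenvalue `λ₁`, its eigenspace is one-dimensional, and
`‖|x⟩⟨x| - δ‖_tr = 2‖|x⟩⟨x| - δ‖ = 2 λ₁`. -/
theorem stmt1 {n : ℕ} (x : Fin n → ℂ) (hx : ∑ i, ‖x i‖ ^ 2 = 1)
    (hnd : ¬ ∃ dvec : Fin n → ℂ, outer x = Matrix.diagonal dvec)
    (δ : Matrix (Fin n) (Fin n) ℂ) (hδ : IsIncoherent δ)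
    (h : (outer x - δ).IsHermitian) :
    ∃ lam1 : ℝ, 0 < lam1 ∧
      (∃! i : Fin n, 0 < h.eigenvalues i) ∧
      (∀ i, 0 < h.eigenvalues i → h.eigenvalues i = lam1) ∧
      Module.finrank ℂ
        (Module.End.eigenspace (Matrix.toLin' (outer x - δ)) (lam1 : ℂ)) = 1 ∧
      traceNorm (outer x - δ) = 2 * lam1 ∧
      opNorm (outer x - δ) = lam1 := by
  obtain ⟨⟨hpos, htr⟩, hdiag⟩ := hδ
  have hsum : ∑ i, h.eigenvalues i = 0 := by
    have := h.trace_eq_sum_eigenvalues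
    rw [trace_sub, trace_outer, hx, htr, Complex.ofReal_one, sub_self] at this
    exact Complex.ofReal_injective (by simpa using this.symm)
  obtain ⟨k, hk⟩ : ∃ k, 0 < h.eigenvalues k := by
    by_contra! hle
    have hzero : h.eigenvalues = 0 := funext fun i =>
      (Finset.sum_eq_zero_iff_of_nonpos fun i _ => hle i).mp hsum i (Finset.mem_univ i)
    have hA : outer x = δ := sub_eq_zero.mp (h.eigenvalues_eq_zero_iff.mp hzero)
    refine hnd ⟨δ.diag, hA.trans ?_⟩
    ext i j
    rcases eq_or_ne i j with rfl | hij
    · simp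
    · rw [hdiag i j hij, diagonal_apply_ne _ hij]
  have huniq : ∀ i, 0 < h.eigenvalues i → i = k := fun i hi =>
    eq_of_eigenvalues_outer_sub_pos hpos h hi hk
  have hnonpos : ∀ i, i ≠ k → h.eigenvalues i ≤ 0 := fun i hi =>
    not_lt.mp fun hlt => hi (huniq i hlt)
  have habs : ∑ i, |h.eigenvalues i| = 2 * h.eigenvalues k := by
    rw [← Finset.add_sum_erase _ _ (Finset.mem_univ k)] at hsum ⊢
    rw [Finset.sum_congr rfl fun i hi => abs_of_nonpos (hnonpos i (Finset.ne_of_mem_erase hi)),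
      Finset.sum_neg_distrib, abs_of_pos hk]
    linarith
  refine ⟨h.eigenvalues k, hk, ⟨k, hk, huniq⟩, fun i hi => by rw [huniq i hi], ?_, ?_, ?_⟩
  · refine le_antisymm (finrank_eigenspace_outer_sub_le_one hpos hk) ?_
    rw [Nat.one_le_iff_ne_zero, ne_eq, Submodule.finrank_eq_zero]
    refine (Submodule.ne_bot_iff _).mpr ⟨h.eigenvectorBasis k, ?_, fun hzero => ?_⟩
    · rw [Module.End.mem_eigenspace_iff, toLin'_apply]
      exact h.mulVec_eigenvectorBasis k
    · simpa [hzero] using h.star_eigenvectorBasis_dotProduct k k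
  · rw [traceNorm, dif_pos h, habs]
  · rw [opNorm, dif_pos h]
    have : Nonempty (Fin n) := ⟨k⟩
    refine le_antisymm (ciSup_le fun i => ?_) ?_
    · rcases eq_or_ne i k with rfl | hi
      · exact (abs_of_pos hk).le
      · have hpair := Finset.add_le_sum (fun j _ => abs_nonneg (h.eigenvalues j))
          (Finset.mem_univ i) (Finset.mem_univ k) hi
        rw [habs, abs_of_pos hk] at hpair
        linarith
    · exact (le_abs_self _).trans
        (le_ciSup (f := fun i => |h.eigenvalues i|) (Set.finite_range _).bddAbove k)
end

section
/- Let A be an n×n density matrix, let D be an incoherent state, and let F = { F : F is a diagonal n×n matrix with real diagonal entries f_1, …, f_n satisfying ∑_j f_j = 0 and f_j ≤ D_{jj} for all j }. Then the following are equivalent: (a) ‖A − D‖_tr = min over all incoherent states δ of ‖A − δ‖_tr; (b) there exists a Hermitian n×n matrix H with operator norm ‖H‖ ≤ 1 such that tr((A − D)H) = ‖A − D‖_tr and tr(FH) ≥ 0 for every F ∈ F. -/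
open Matrix BigOperators
open scoped ComplexOrder

section TraceNorm

variable {m : Type*}

section Fintype

variable [Fintype m]

lemma isClosed_setOf_posSemidef : IsClosed {H : Matrix m m ℂ | H.PosSemidef} := by
  simp only [posSemidef_iff_dotProduct_mulVec, IsHermitian, Set.ofPred_and, Set.ofPred_forall]
  refine (isClosed_eq (by fun_prop) continuous_id).inter (isClosed_iInter fun x => ?_)
  simp only [Complex.le_def, Set.ofPred_and]
  refine (isClosed_le continuous_const ?_).inter (isClosed_eq continuous_const ?_) <;> fun_prop

lemma Matrix.IsHermitian.im_trace_mul_eq_zero {X Y : Matrix m m ℂ} (hX : X.IsHermitian)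
    (hY : Y.IsHermitian) : (X * Y).trace.im = 0 := by
  have h : star (X * Y).trace = (X * Y).trace := by
    rw [← trace_conjTranspose, conjTranspose_mul, hX.eq, hY.eq, trace_mul_comm]
  exact Complex.conj_eq_iff_im.mp h

end Fintype

variable [DecidableEq m]

/-- The Hermitian contractions, as the matrices `H` with `-1 ≤ H ≤ 1`. -/
def contractions (m : Type*) [DecidableEq m] : Set (Matrix m m ℂ) :=
  {H | (1 - H).PosSemidef ∧ (1 + H).PosSemidef}

lemma isHermitian_of_mem_contractions {H : Matrix m m ℂ} (hH : H ∈ contractions m) :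
    H.IsHermitian := by
  have h := (isHermitian_one (n := m) (α := ℂ)).sub hH.1.isHermitian
  simpa using h

lemma abs_re_diag_le_one_of_mem_contractions {H : Matrix m m ℂ} (hH : H ∈ contractions m)
    (i : m) : |(H i i).re| ≤ 1 := by
  have h₁ := (Complex.le_def.mp (hH.1.diag_nonneg (i := i))).1
  have h₂ := (Complex.le_def.mp (hH.2.diag_nonneg (i := i))).1
  simp at h₁ h₂
  exact abs_le.mpr ⟨by linarith, by linarith⟩

lemma diagonal_mem_contractions {d : m → ℝ} (hd : ∀ i, |d i| ≤ 1) :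
    diagonal (fun i => (d i : ℂ)) ∈ contractions m := by
  refine ⟨?_, ?_⟩
  · rw [← diagonal_one, diagonal_sub, posSemidef_diagonal_iff]
    intro i
    have := (abs_le.mp (hd i)).2
    exact_mod_cast sub_nonneg.mpr this
  · rw [← diagonal_one, diagonal_add, posSemidef_diagonal_iff]
    intro i
    have := (abs_le.mp (hd i)).1
    have h : (0 : ℝ) ≤ 1 + d i := by linarith
    exact_mod_cast h

lemma convex_contractions : Convex ℝ (contractions m) := by
  intro H hH G hG a b ha hb hab
  have e : (1 : Matrix m m ℂ) = a • 1 + b • 1 := by rw [← add_smul, hab, one_smul]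
  refine ⟨?_, ?_⟩
  · have h := (hH.1.smul ha).add (hG.1.smul hb)
    convert h using 1
    conv_lhs => rw [e]
    simp only [smul_sub]
    abel
  · have h := (hH.2.smul ha).add (hG.2.smul hb)
    convert h using 1
    conv_lhs => rw [e]
    simp only [smul_add]
    abel

variable [Fintype m]

lemma conj_mem_contractions {H : Matrix m m ℂ} (hH : H ∈ contractions m)
    {U : Matrix m m ℂ} (hU : U * Uᴴ = 1) : U * H * Uᴴ ∈ contractions m := by
  refine ⟨?_, ?_⟩
  · have h := hH.1.mul_mul_conjTranspose_same U
    simpa [mul_sub, sub_mul, hU] using h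
  · have h := hH.2.mul_mul_conjTranspose_same U
    simpa [mul_add, add_mul, hU] using h

lemma Matrix.IsHermitian.exists_unitary_diagonalization {X : Matrix m m ℂ} (hX : X.IsHermitian) :
    ∃ U : Matrix m m ℂ, U * Uᴴ = 1 ∧ Uᴴ * U = 1 ∧
      X = U * diagonal (fun i => (hX.eigenvalues i : ℂ)) * Uᴴ := by
  refine ⟨hX.eigenvectorUnitary, ?_, ?_, ?_⟩
  · exact Unitary.coe_mul_star_self hX.eigenvectorUnitary
  · exact Unitary.coe_star_mul_self hX.eigenvectorUnitary
  · exact hX.spectral_theorem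

lemma mem_contractions_iff_abs_eigenvalues_le {H : Matrix m m ℂ} (hH : H.IsHermitian) :
    H ∈ contractions m ↔ ∀ i, |hH.eigenvalues i| ≤ 1 := by
  obtain ⟨U, hU, hU', h⟩ := hH.exists_unitary_diagonalization
  refine ⟨fun hc i => ?_, fun hc => ?_⟩
  · have hd : Uᴴ * H * U = diagonal (fun i => (hH.eigenvalues i : ℂ)) := by
      conv_lhs => rw [h]
      calc Uᴴ * (U * diagonal (fun i => (hH.eigenvalues i : ℂ)) * Uᴴ) * U
          = (Uᴴ * U) * diagonal (fun i => (hH.eigenvalues i : ℂ)) * (Uᴴ * U) := by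
            simp only [mul_assoc]
        _ = _ := by rw [hU']; simp
    have h₁ := conj_mem_contractions hc (U := Uᴴ) (by simpa using hU')
    rw [conjTranspose_conjTranspose, hd] at h₁
    simpa using abs_re_diag_le_one_of_mem_contractions h₁ i
  · rw [h]
    exact conj_mem_contractions (diagonal_mem_contractions hc) hU

lemma mem_contractions_iff_opNorm_le {H : Matrix m m ℂ} (hH : H.IsHermitian) :
    H ∈ contractions m ↔ opNorm H ≤ 1 := by
  rw [mem_contractions_iff_abs_eigenvalues_le hH, opNorm, dif_pos hH]
  refine ⟨fun h => Real.iSup_le h zero_le_one, fun h i => ?_⟩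
  exact (le_ciSup (Set.finite_range fun i => |hH.eigenvalues i|).bddAbove i).trans h

lemma re_trace_mul_le_traceNorm {X H : Matrix m m ℂ} (hX : X.IsHermitian)
    (hH : H ∈ contractions m) : (X * H).trace.re ≤ traceNorm X := by
  obtain ⟨U, hU, hU', h⟩ := hX.exists_unitary_diagonalization
  have hG := conj_mem_contractions hH (U := Uᴴ) (by simpa using hU')
  rw [conjTranspose_conjTranspose] at hG
  have ht : (X * H).trace = ∑ i, (hX.eigenvalues i : ℂ) * (Uᴴ * H * U) i i := by
    conv_lhs => rw [h, mul_assoc, mul_assoc, trace_mul_comm, mul_assoc]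
    simp [trace, diagonal_mul, mul_assoc]
  rw [ht, traceNorm, dif_pos hX, Complex.re_sum]
  refine Finset.sum_le_sum fun i _ => ?_
  rw [Complex.re_ofReal_mul]
  calc _ ≤ |hX.eigenvalues i * ((Uᴴ * H * U) i i).re| := le_abs_self _
    _ ≤ |hX.eigenvalues i| := by
      rw [abs_mul]
      exact mul_le_of_le_one_right (abs_nonneg _) (abs_re_diag_le_one_of_mem_contractions hG i)

lemma exists_mem_contractions_trace_mul_eq_traceNorm {X : Matrix m m ℂ} (hX : X.IsHermitian) :
    ∃ H ∈ contractions m, (X * H).trace = (traceNorm X : ℂ) := by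
  obtain ⟨U, hU, hU', h⟩ := hX.exists_unitary_diagonalization
  let s : m → ℝ := fun i => SignType.sign (hX.eigenvalues i)
  have hs (i : m) : |s i| ≤ 1 := by
    rcases lt_trichotomy (hX.eigenvalues i) 0 with hi | hi | hi <;> simp [s, hi]
  refine ⟨U * diagonal (fun i => (s i : ℂ)) * Uᴴ,
    conj_mem_contractions (diagonal_mem_contractions hs) hU, ?_⟩
  have hm : X * (U * diagonal (fun i => (s i : ℂ)) * Uᴴ) =
      U * (diagonal (fun i => ((|hX.eigenvalues i| : ℝ) : ℂ)) * Uᴴ) := by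
    conv_lhs => rw [h]
    calc _ = U * (diagonal (fun i => (hX.eigenvalues i : ℂ)) * ((Uᴴ * U) *
            diagonal (fun i => (s i : ℂ))) * Uᴴ) := by simp only [mul_assoc]
      _ = _ := by
        rw [hU', one_mul, diagonal_mul_diagonal]
        simp only [s, ← Complex.ofReal_mul, self_mul_sign]
  rw [hm, trace_mul_comm, mul_assoc, hU', mul_one, traceNorm, dif_pos hX]
  simp [trace]

lemma norm_apply_le_of_mem_contractions {H : Matrix m m ℂ} (hH : H ∈ contractions m) (i j : m) :
    ‖H i j‖ ≤ Fintype.card m := by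
  have hh := isHermitian_of_mem_contractions hH
  have hl := (mem_contractions_iff_abs_eigenvalues_le hh).mp hH
  obtain ⟨U, hU, hU', h⟩ := hh.exists_unitary_diagonalization
  have hUm : U ∈ unitaryGroup m ℂ := mem_unitaryGroup_iff.mpr hU
  have e : H i j = ∑ k, U i k * hh.eigenvalues k * star (U j k) := by
    conv_lhs => rw [h, mul_apply]
    simp [mul_diagonal]
  rw [e]
  refine (norm_sum_le _ _).trans ?_
  have hk (k : m) : ‖U i k * hh.eigenvalues k * star (U j k)‖ ≤ 1 := by
    rw [norm_mul, norm_mul, norm_star, Complex.norm_real]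
    have h₁ := entry_norm_bound_of_unitary hUm i k
    have h₂ := entry_norm_bound_of_unitary hUm j k
    exact mul_le_one₀ (mul_le_one₀ h₁ (norm_nonneg _) (hl k)) (norm_nonneg _) h₂
  simpa using Finset.sum_le_sum fun k (_ : k ∈ Finset.univ) => hk k

lemma isCompact_contractions : IsCompact (contractions m) := by
  have hK : IsCompact (Set.pi Set.univ fun _ : m => Set.pi Set.univ fun _ : m =>
      Metric.closedBall (0 : ℂ) (Fintype.card m)) :=
    isCompact_univ_pi fun _ => isCompact_univ_pi fun _ => isCompact_closedBall _ _
  refine IsCompact.of_isClosed_subset hK ?_ fun H hH i _ j _ => ?_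
  · exact (isClosed_setOf_posSemidef.preimage (continuous_const.sub continuous_id)).inter
      (isClosed_setOf_posSemidef.preimage (continuous_const.add continuous_id))
  · simpa using norm_apply_le_of_mem_contractions hH i j

lemma isIncoherent_diagonal_of_mem_stdSimplex {d : m → ℝ} (hd : d ∈ stdSimplex ℝ m) :
    IsIncoherent (diagonal fun i => (d i : ℂ)) := by
  refine ⟨⟨posSemidef_diagonal_iff.mpr fun i => by exact_mod_cast hd.1 i, ?_⟩,
    fun i j hij => diagonal_apply_ne _ hij⟩
  rw [trace_diagonal]
  exact_mod_cast hd.2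

lemma IsIncoherent.exists_eq_diagonal {D : Matrix m m ℂ} (hD : IsIncoherent D) :
    ∃ d ∈ stdSimplex ℝ m, D = diagonal fun i => (d i : ℂ) := by
  have h (i : m) := Complex.nonneg_iff.mp (hD.1.1.diag_nonneg (i := i))
  have e : D = diagonal fun i => ((D i i).re : ℂ) := by
    ext i j
    by_cases hij : i = j
    · subst hij
      rw [diagonal_apply_eq]
      exact Complex.ext rfl (h i).2.symm
    · rw [hD.2 i j hij, diagonal_apply_ne _ hij]
  refine ⟨fun i => (D i i).re, ⟨fun i => (h i).1, ?_⟩, e⟩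
  have ht := congrArg Complex.re hD.1.2
  simpa [trace] using ht

lemma exists_mem_contractions_forall_le_re_trace {A : Matrix m m ℂ} (hA : A.IsHermitian) {t : ℝ}
    (ht : ∀ d ∈ stdSimplex ℝ m, t ≤ traceNorm (A - diagonal fun i => (d i : ℂ)))
    (hne : (stdSimplex ℝ m).Nonempty) :
    ∃ H ∈ contractions m, ∀ d ∈ stdSimplex ℝ m,
      t ≤ ((A - diagonal fun i => (d i : ℂ)) * H).trace.re := by
  let f : (m → ℝ) → Matrix m m ℂ → ℝ := fun d H =>
    ((A - diagonal fun i => (d i : ℂ)) * H).trace.re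
  have hf (d : m → ℝ) (H : Matrix m m ℂ) :
      f d H = (A * H).trace.re - ∑ i, d i * (H i i).re := by
    simp [f, sub_mul, trace, diagonal_mul]
  have hconv (H : Matrix m m ℂ) : ConvexOn ℝ (stdSimplex ℝ m) fun d => f d H := by
    refine ⟨convex_stdSimplex ℝ m, fun x _ y _ a b _ _ hab => le_of_eq ?_⟩
    simp only [hf, Pi.add_apply, Pi.smul_apply, smul_eq_mul, add_mul, Finset.sum_add_distrib,
      mul_assoc, ← Finset.mul_sum]
    linear_combination -(A * H).trace.re * hab
  have hconc (d : m → ℝ) : ConcaveOn ℝ (contractions m) fun H => f d H := by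
    refine ⟨convex_contractions, fun x _ y _ a b _ _ _ => le_of_eq ?_⟩
    simp [f, mul_add, trace_add, trace_smul]
  have h0 : (0 : Matrix m m ℂ) ∈ contractions m := by
    refine ⟨?_, ?_⟩ <;> simpa using PosSemidef.one
  obtain ⟨a, ha, H, hH, hs⟩ := Sion.exists_isSaddlePointOn (f := f) hne (convex_stdSimplex ℝ m)
    (isCompact_stdSimplex ℝ m)
    (fun H _ => Continuous.lowerSemicontinuous (by fun_prop) |>.lowerSemicontinuousOn _)
    (fun H _ => (hconv H).quasiconvexOn)
    convex_contractions ⟨0, h0⟩ isCompact_contractions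
    (fun d _ => Continuous.upperSemicontinuous (by fun_prop) |>.upperSemicontinuousOn _)
    (fun d _ => (hconc d).quasiconcaveOn)
  refine ⟨H, hH, fun d hd => ?_⟩
  obtain ⟨G, hG, hGt⟩ := exists_mem_contractions_trace_mul_eq_traceNorm
    (hA.sub (isIncoherent_diagonal_of_mem_stdSimplex ha).1.1.isHermitian)
  calc t ≤ _ := ht a ha
    _ = f a G := by simp only [f, hGt, Complex.ofReal_re]
    _ ≤ f d H := hs d hd G hG

end TraceNorm

/-- for a density matrix `A` and incoherent state `D`, `D` minimizes the
trace-norm distance to `A` among incoherent states iff there is a Hermitian contraction `H`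
with `tr((A - D)H) = ‖A - D‖_tr` and `tr(FH) ≥ 0` for every diagonal real `F` with
`∑ f j = 0` and `f j ≤ D j j`. -/
theorem stmt3 {n : ℕ} (A : Matrix (Fin n) (Fin n) ℂ) (hA : IsDensity A)
    (D : Matrix (Fin n) (Fin n) ℂ) (hD : IsIncoherent D) :
    (∀ δ, IsIncoherent δ → traceNorm (A - D) ≤ traceNorm (A - δ)) ↔
    (∃ H : Matrix (Fin n) (Fin n) ℂ, H.IsHermitian ∧ opNorm H ≤ 1 ∧
      ((A - D) * H).trace = (traceNorm (A - D) : ℂ) ∧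
      ∀ f : Fin n → ℝ, (∑ j, f j = 0) → (∀ j, (f j : ℂ) ≤ D j j) →
        0 ≤ ((Matrix.diagonal fun j => (f j : ℂ)) * H).trace) := by
  have hAh := hA.1.isHermitian
  obtain ⟨d, hd, rfl⟩ := hD.exists_eq_diagonal
  have hX := hAh.sub hD.1.1.isHermitian
  constructor
  · intro hmin
    obtain ⟨H, hH, hle⟩ := exists_mem_contractions_forall_le_re_trace hAh
      (fun e he => hmin _ (isIncoherent_diagonal_of_mem_stdSimplex he)) ⟨d, hd⟩
    have hHh := isHermitian_of_mem_contractions hH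
    have heq := le_antisymm (re_trace_mul_le_traceNorm hX hH) (hle d hd)
    refine ⟨H, hHh, (mem_contractions_iff_opNorm_le hHh).mp hH, ?_, fun f hf hfd => ?_⟩
    · exact Complex.ext heq (hX.im_trace_mul_eq_zero hHh)
    · have hfd' (j : Fin n) : f j ≤ d j := by simpa using hfd j
      have hδ : d - f ∈ stdSimplex ℝ (Fin n) :=
        ⟨fun j => sub_nonneg.mpr (hfd' j), by simp [Finset.sum_sub_distrib, hf, hd.2]⟩
      have hF : (diagonal fun j => (f j : ℂ)).IsHermitian :=
        isHermitian_diagonal_of_self_adjoint _ (by ext; simp)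
      have hsub : A - diagonal (fun j => ((d - f) j : ℂ)) =
          (A - diagonal fun j => (d j : ℂ)) + diagonal fun j => (f j : ℂ) := by
        rw [sub_add, diagonal_sub]
        simp
      have h := hle _ hδ
      rw [hsub, add_mul, trace_add, Complex.add_re, heq] at h
      exact Complex.nonneg_iff.mpr ⟨by linarith, (hF.im_trace_mul_eq_zero hHh).symm⟩
  · rintro ⟨H, hHh, hop, hopt, hF⟩ δ hδ
    have hH := (mem_contractions_iff_opNorm_le hHh).mpr hop
    obtain ⟨e, he, rfl⟩ := hδ.exists_eq_diagonal
    have h := hF (d - e) (by simp [Finset.sum_sub_distrib, hd.2, he.2])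
      (fun j => by simpa using he.1 j)
    have hsub : A - diagonal (fun j => (e j : ℂ)) =
        (A - diagonal fun j => (d j : ℂ)) + diagonal fun j => ((d - e) j : ℂ) := by
      rw [sub_add, diagonal_sub]
      simp
    have hle := re_trace_mul_le_traceNorm (hAh.sub hδ.1.1.isHermitian) hH
    rw [hsub, add_mul, trace_add, hopt, Complex.add_re, Complex.ofReal_re, ← hsub] at hle
    linarith [(Complex.nonneg_iff.mp h).1]
end

section
/- Let x = (x_1, …, x_n) be a real unit vector with x_1 ≥ x_2 ≥ … ≥ x_n ≥ 0, let k be the maximum element of { ℓ ∈ {1, …, n} : x_ℓ > q_ℓ }, and set q = q_k and μ = q·s_k + m_k. Define d_j = (x_j − q)/(s_k − k·q) for 1 ≤ j ≤ k and let D = diag(d_1, …, d_k, 0, …, 0) and v = (q, …, q, x_{k+1}, …, x_n) (with q in the first k coordinates). Then s_k − k·q > 0, each d_j > 0, ∑_{j=1}^{k} d_j = 1 (so D is an incoherent state), and (|x⟩⟨x| − D)·v = μ·v. -/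
open Matrix BigOperators
open scoped ComplexOrder

/-- `ent x ℓ` is the 1-based entry `x_ℓ` of `x` (junk value `0` outside `{1,…,n}`). -/
noncomputable def ent {n : ℕ} (x : Fin n → ℝ) (ℓ : ℕ) : ℝ :=
  if h : 1 ≤ ℓ ∧ ℓ ≤ n then x ⟨ℓ - 1, by omega⟩ else 0

/-- `s_ℓ = ∑_{j=1}^{ℓ} x_j`. -/
noncomputable def sVal {n : ℕ} (x : Fin n → ℝ) (ℓ : ℕ) : ℝ :=
  ∑ j ∈ Finset.Icc 1 ℓ, ent x j

/-- `m_ℓ = ∑_{j=ℓ+1}^{n} x_j²`. -/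
noncomputable def mVal {n : ℕ} (x : Fin n → ℝ) (ℓ : ℕ) : ℝ :=
  ∑ j ∈ Finset.Icc (ℓ + 1) n, (ent x j) ^ 2

/-- `p_ℓ = s_ℓ² − 1 − ℓ·m_ℓ`. -/
noncomputable def pVal {n : ℕ} (x : Fin n → ℝ) (ℓ : ℕ) : ℝ :=
  (sVal x ℓ) ^ 2 - 1 - ℓ * mVal x ℓ

/-- `q_ℓ = (p_ℓ + √(p_ℓ² + 4·ℓ·m_ℓ·s_ℓ²)) / (2·ℓ·s_ℓ)`. -/
noncomputable def qVal {n : ℕ} (x : Fin n → ℝ) (ℓ : ℕ) : ℝ :=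
  (pVal x ℓ + Real.sqrt ((pVal x ℓ) ^ 2 + 4 * ℓ * mVal x ℓ * (sVal x ℓ) ^ 2)) /
    (2 * ℓ * sVal x ℓ)

/-- The diagonal matrix `D = diag(d_1, …, d_k, 0, …, 0)` with
`d_j = (x_j − q_k)/(s_k − k·q_k)` (real entries). -/
noncomputable def Dmat {n : ℕ} (x : Fin n → ℝ) (k : ℕ) : Matrix (Fin n) (Fin n) ℝ :=
  Matrix.diagonal fun i =>
    if (i : ℕ) + 1 ≤ k then (ent x ((i : ℕ) + 1) - qVal x k) / (sVal x k - k * qVal x k)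
    else 0

/-- The vector `v = (q_k, …, q_k, x_{k+1}, …, x_n)` with `q_k` in the first `k` coordinates. -/
noncomputable def vvec {n : ℕ} (x : Fin n → ℝ) (k : ℕ) : Fin n → ℝ :=
  fun i => if (i : ℕ) + 1 ≤ k then qVal x k else x i

open Finset in
theorem sum_fin_ite_succ_le {n k : ℕ} (hk : k ≤ n) (f g : ℕ → ℝ) :
    ∑ i : Fin n, (if (i : ℕ) + 1 ≤ k then f (i + 1) else g (i + 1)) =
      ∑ j ∈ Icc 1 k, f j + ∑ j ∈ Icc (k + 1) n, g j := by
  rw [Fin.sum_univ_eq_sum_range (fun i => if i + 1 ≤ k then f (i + 1) else g (i + 1)) n,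
    Finset.range_eq_Ico, Finset.sum_Ico_add' (fun i => if i ≤ k then f i else g i) 0 n 1,
    Finset.sum_ite]
  congr 1 <;> refine Finset.sum_congr ?_ fun _ _ => rfl <;> ext j <;>
    simp only [mem_filter, mem_Ico, mem_Icc] <;> omega

theorem ent_succ {n : ℕ} (x : Fin n → ℝ) (i : Fin n) : ent x ((i : ℕ) + 1) = x i := by
  simp [ent]

theorem ent_nonneg {n : ℕ} {x : Fin n → ℝ} (hx : ∀ j, 0 ≤ x j) (ℓ : ℕ) : 0 ≤ ent x ℓ := by
  unfold ent
  split_ifs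
  · exact hx _
  · exact le_rfl

theorem ent_le_ent {n : ℕ} {x : Fin n → ℝ} (hx : ∀ i j : Fin n, i ≤ j → x j ≤ x i)
    {j k : ℕ} (hj : 1 ≤ j) (hjk : j ≤ k) (hk : k ≤ n) : ent x k ≤ ent x j := by
  rw [ent, ent, dif_pos ⟨hj.trans hjk, hk⟩, dif_pos ⟨hj, hjk.trans hk⟩]
  exact hx _ _ (Nat.sub_le_sub_right hjk 1)

theorem sVal_pos_of_qVal_lt {n : ℕ} {x : Fin n → ℝ} (hx : ∀ j, 0 ≤ x j) {k : ℕ} (hk : 1 ≤ k)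
    (hkq : qVal x k < ent x k) : 0 < sVal x k := by
  have hle : ent x k ≤ sVal x k :=
    Finset.single_le_sum (fun j _ => ent_nonneg hx j) (Finset.mem_Icc.2 ⟨hk, le_rfl⟩)
  refine ((ent_nonneg hx k).trans hle).lt_of_ne fun h => ?_
  have hq : qVal x k = 0 := by simp [qVal, ← h]
  linarith

theorem qVal_quadratic {n : ℕ} {x : Fin n → ℝ} {k : ℕ} (hk : 1 ≤ k) (hs : sVal x k ≠ 0) :
    k * sVal x k * qVal x k ^ 2 = pVal x k * qVal x k + mVal x k * sVal x k := by
  have hk' : (k : ℝ) ≠ 0 := by positivity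
  have hm : 0 ≤ mVal x k := Finset.sum_nonneg fun _ _ => sq_nonneg _
  have hr := Real.sq_sqrt (show 0 ≤ pVal x k ^ 2 + 4 * k * mVal x k * sVal x k ^ 2 by positivity)
  unfold qVal
  generalize √(pVal x k ^ 2 + 4 * k * mVal x k * sVal x k ^ 2) = r at hr ⊢
  field_simp
  linear_combination hr

theorem qVal_mul_sVal_add_mVal_mul {n : ℕ} {x : Fin n → ℝ} {k : ℕ} (hk : 1 ≤ k)
    (hs : sVal x k ≠ 0) :
    (qVal x k * sVal x k + mVal x k) * (sVal x k - k * qVal x k) = qVal x k := by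
  have h := qVal_quadratic hk hs
  unfold pVal at h
  linear_combination -h

theorem dotProduct_vvec {n k : ℕ} (hk : k ≤ n) (x : Fin n → ℝ) :
    ∑ i, x i * vvec x k i = qVal x k * sVal x k + mVal x k := by
  rw [sVal, mVal, Finset.mul_sum, ← sum_fin_ite_succ_le hk]
  refine Finset.sum_congr rfl fun i _ => ?_
  rw [ent_succ, vvec]
  split_ifs <;> ring

/-- with `k` the maximal index with `x_k > q_k`, setting `q = q_k` and
`μ = q·s_k + m_k`, one has `s_k − k·q > 0`, each `d_j > 0`, `∑_{j=1}^k d_j = 1`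
(so `D` is an incoherent state) and `(|x⟩⟨x| − D)·v = μ·v`. -/
theorem stmt6 {n : ℕ} (hn : 1 ≤ n) (x : Fin n → ℝ)
    (hunit : ∑ j, (x j) ^ 2 = 1)
    (hmono : ∀ i j : Fin n, i ≤ j → x j ≤ x i)
    (hnonneg : ∀ j, 0 ≤ x j)
    (k : ℕ) (hk : k ∈ Finset.Icc 1 n) (hkq : qVal x k < ent x k)
    (hkmax : ∀ ℓ ∈ Finset.Icc 1 n, qVal x ℓ < ent x ℓ → ℓ ≤ k) :
    0 < sVal x k - k * qVal x k ∧
    (∀ j ∈ Finset.Icc 1 k, 0 < (ent x j - qVal x k) / (sVal x k - k * qVal x k)) ∧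
    (∑ j ∈ Finset.Icc 1 k, (ent x j - qVal x k) / (sVal x k - k * qVal x k)) = 1 ∧
    (Dmat x k).PosSemidef ∧ (Dmat x k).trace = 1 ∧
    ((Matrix.of fun i j : Fin n => x i * x j) - Dmat x k).mulVec (vvec x k) =
      (qVal x k * sVal x k + mVal x k) • vvec x k := by
  obtain ⟨hk1, hkn⟩ := Finset.mem_Icc.1 hk
  have hs := sVal_pos_of_qVal_lt hnonneg hk1 hkq
  have hpos : ∀ j ∈ Finset.Icc 1 k, 0 < ent x j - qVal x k := fun j hj => by
    obtain ⟨hj1, hjk⟩ := Finset.mem_Icc.1 hj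
    linarith [ent_le_ent hmono hj1 hjk hkn]
  have hsum : ∑ j ∈ Finset.Icc 1 k, (ent x j - qVal x k) = sVal x k - k * qVal x k := by
    simp [Finset.sum_sub_distrib, sVal]
  have hgap : 0 < sVal x k - k * qVal x k :=
    hsum ▸ Finset.sum_pos hpos ⟨1, Finset.mem_Icc.2 ⟨le_rfl, hk1⟩⟩
  have hd : ∀ j ∈ Finset.Icc 1 k, 0 < (ent x j - qVal x k) / (sVal x k - k * qVal x k) :=
    fun j hj => div_pos (hpos j hj) hgap
  have hone : ∑ j ∈ Finset.Icc 1 k, (ent x j - qVal x k) / (sVal x k - k * qVal x k) = 1 := by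
    rw [← Finset.sum_div, hsum, div_self hgap.ne']
  refine ⟨hgap, hd, hone, ?_, ?_, ?_⟩
  · refine Matrix.PosSemidef.diagonal fun i => ?_
    dsimp only [Pi.zero_apply]
    split_ifs with h
    · exact (hd _ (Finset.mem_Icc.2 ⟨Nat.le_add_left 1 _, h⟩)).le
    · exact le_rfl
  · rw [Dmat, Matrix.trace_diagonal, sum_fin_ite_succ_le hkn
      (fun j => (ent x j - qVal x k) / (sVal x k - k * qVal x k)) fun _ => 0, hone]
    simp
  · ext i
    have hμ := eq_div_of_mul_eq hgap.ne' (qVal_mul_sVal_add_mVal_mul hk1 hs.ne')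
    have hrow : ((Matrix.of fun i j : Fin n => x i * x j).mulVec (vvec x k)) i =
        x i * (qVal x k * sVal x k + mVal x k) := by
      rw [← dotProduct_vvec hkn, Finset.mul_sum]
      simp [Matrix.mulVec, dotProduct, mul_assoc]
    rw [Matrix.sub_mulVec, Pi.sub_apply, hrow, Dmat, Matrix.mulVec_diagonal, Pi.smul_apply,
      smul_eq_mul, ent_succ, vvec]
    split_ifs
    · linear_combination (x i - qVal x k) * hμ
    · ring
end

section
/- Let x = (x_1, …, x_n) be a real unit vector with x_1 ≥ x_2 ≥ … ≥ x_n ≥ 0, let k be the maximum element of { ℓ ∈ {1, …, n} : x_ℓ > q_ℓ }, and let D = diag(d_1, …, d_k, 0, …, 0) with d_j = (x_j − q_k)/(s_k − k·q_k) for 1 ≤ j ≤ k. Then D is the UNIQUE incoherent state attaining min_{δ incoherent} ‖|x⟩⟨x| − δ‖_tr, and it is also the unique incoherent state attaining min_{δ incoherent} ‖|x⟩⟨x| − δ‖: any incoherent state δ with ‖|x⟩⟨x| − δ‖_tr = min_{δ' incoherent} ‖|x⟩⟨x| − δ'‖_tr satisfies δ = D. -/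
open Matrix BigOperators
open scoped ComplexOrder

/-- The incoherent candidate `D = diag(d_1, …, d_k, 0, …, 0)` with
`d_j = (x_j − q_k)/(s_k − k·q_k)`, as a complex matrix. -/
noncomputable def DmatC {n : ℕ} (x : Fin n → ℝ) (k : ℕ) : Matrix (Fin n) (Fin n) ℂ :=
  Matrix.diagonal fun i =>
    if (i : ℕ) + 1 ≤ k then
      (((ent x ((i : ℕ) + 1) - qVal x k) / (sVal x k - k * qVal x k) : ℝ) : ℂ)
    else 0

/-- `|x⟩⟨x|` for a real vector `x`, as a complex matrix. -/
noncomputable def outerR {n : ℕ} (x : Fin n → ℝ) : Matrix (Fin n) (Fin n) ℂ :=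
  outer fun i => (x i : ℂ)

/-! ### Rank-one minus diagonal matrices -/

/-- For a diagonal `g ≥ 0`, an eigenvector `u` of `|x⟩⟨x| - diag g` solves the secular system. -/
theorem eigenvector_secular {n : ℕ} (x g : Fin n → ℝ) (l : ℝ) (u : Fin n → ℂ)
    (hu : (outerR x - diagonal fun i => (g i : ℂ)) *ᵥ u = l • u) (i : Fin n) :
    ((l + g i : ℝ) : ℂ) * u i = x i * ∑ j, (x j : ℂ) * u j := by
  have h := congrFun hu i
  rw [Matrix.sub_mulVec, Pi.sub_apply, mulVec_diagonal, Pi.smul_apply] at h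
  have h2 : (outerR x *ᵥ u) i = x i * ∑ j, (x j : ℂ) * u j := by
    simp [outerR, outer, mulVec, dotProduct, Finset.mul_sum, mul_assoc]
  rw [h2, Complex.real_smul] at h
  push_cast
  linear_combination -h

/-- A nonzero eigenvector with positive eigenvalue is not orthogonal to `x`. -/
theorem eigenvector_overlap_ne_zero {n : ℕ} {x g : Fin n → ℝ} (hg : ∀ i, 0 ≤ g i) {l : ℝ}
    (hl : 0 < l) {u : Fin n → ℂ} (hu0 : u ≠ 0)
    (hu : (outerR x - diagonal fun i => (g i : ℂ)) *ᵥ u = l • u) :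
    ∑ j, (x j : ℂ) * u j ≠ 0 := by
  intro h0
  apply hu0
  funext i
  have h := eigenvector_secular x g l u hu i
  rw [h0, mul_zero, mul_eq_zero] at h
  rcases h with h | h
  · have : l + g i = 0 := by exact_mod_cast h
    linarith [hg i]
  · exact h

theorem eigenvector_eq {n : ℕ} {x g : Fin n → ℝ} (hg : ∀ i, 0 ≤ g i) {l : ℝ}
    (hl : 0 < l) {u : Fin n → ℂ}
    (hu : (outerR x - diagonal fun i => (g i : ℂ)) *ᵥ u = l • u) (i : Fin n) :
    u i = ((x i / (l + g i) : ℝ) : ℂ) * ∑ j, (x j : ℂ) * u j := by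
  have h := eigenvector_secular x g l u hu i
  have hne : ((l + g i : ℝ) : ℂ) ≠ 0 := by
    have : l + g i ≠ 0 := by linarith [hg i]
    exact_mod_cast this
  rw [Complex.ofReal_div, div_mul_eq_mul_div, eq_div_iff hne, ← h, mul_comm]

/-- The secular equation for a positive eigenvalue. -/
theorem secular_equation {n : ℕ} {x g : Fin n → ℝ} (hg : ∀ i, 0 ≤ g i) {l : ℝ}
    (hl : 0 < l) {u : Fin n → ℂ} (hu0 : u ≠ 0)
    (hu : (outerR x - diagonal fun i => (g i : ℂ)) *ᵥ u = l • u) :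
    ∑ i, x i * (x i / (l + g i)) = 1 := by
  have ha := eigenvector_overlap_ne_zero hg hl hu0 hu
  have h1 : ((∑ i, x i * (x i / (l + g i)) : ℝ) : ℂ) * (∑ j, (x j : ℂ) * u j)
      = ∑ j, (x j : ℂ) * u j := by
    conv_rhs => enter [2, j]; rw [eigenvector_eq hg hl hu j]
    rw [Complex.ofReal_sum, Finset.sum_mul]
    refine Finset.sum_congr rfl fun i _ => ?_
    push_cast
    ring
  have h2 := mul_right_cancel₀ ha (h1.trans (one_mul _).symm)
  exact_mod_cast h2

theorem isHermitian_outerR_sub_diagonal {n : ℕ} (x g : Fin n → ℝ) :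
    (outerR x - diagonal fun i => (g i : ℂ)).IsHermitian := by
  apply Matrix.IsHermitian.sub
  · ext i j
    simp [outerR, outer, mul_comm]
  · apply Matrix.isHermitian_diagonal_of_self_adjoint
    funext i
    simp

/-- `|x⟩⟨x| - diag g` with `g ≥ 0` has at most one positive eigenvalue. -/
theorem eigenvalues_pos_unique {n : ℕ} {x g : Fin n → ℝ} (hx : x ≠ 0) (hg : ∀ i, 0 ≤ g i)
    (hA : (outerR x - diagonal fun i => (g i : ℂ)).IsHermitian) {i j : Fin n}
    (hi : 0 < hA.eigenvalues i) (hj : 0 < hA.eigenvalues j) : i = j := by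
  by_contra hij
  have hui := hA.mulVec_eigenvectorBasis i
  have huj := hA.mulVec_eigenvectorBasis j
  have hne (k : Fin n) : (hA.eigenvectorBasis k).ofLp ≠ 0 := by
    intro h
    exact hA.eigenvectorBasis.toBasis.ne_zero k (by
      rw [OrthonormalBasis.coe_toBasis]
      ext l
      exact congrFun h l)
  have hai := eigenvector_overlap_ne_zero hg hi (hne i) hui
  have haj := eigenvector_overlap_ne_zero hg hj (hne j) huj
  have horth : inner ℂ (hA.eigenvectorBasis i) (hA.eigenvectorBasis j) = 0 :=
    hA.eigenvectorBasis.orthonormal.2 hij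
  rw [PiLp.inner_apply] at horth
  set a := ∑ k, (x k : ℂ) * (hA.eigenvectorBasis i).ofLp k with ha
  set b := ∑ k, (x k : ℂ) * (hA.eigenvectorBasis j).ofLp k with hb
  set S : ℝ := ∑ k, x k / (hA.eigenvalues i + g k) * (x k / (hA.eigenvalues j + g k)) with hS
  have hsum : (S : ℂ) * (star a * b) = 0 := by
    rw [← horth, hS, Complex.ofReal_sum, Finset.sum_mul]
    refine Finset.sum_congr rfl fun k _ => ?_
    rw [eigenvector_eq hg hi hui k, eigenvector_eq hg hj huj k, ← ha, ← hb]
    simp only [RCLike.inner_apply, map_mul, Complex.conj_ofReal, Complex.ofReal_mul,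
      RCLike.star_def]
    ring
  have hSpos : 0 < S := by
    obtain ⟨k, hk⟩ := Function.ne_iff.mp hx
    have hterm (k : Fin n) : x k / (hA.eigenvalues i + g k) * (x k / (hA.eigenvalues j + g k))
        = x k ^ 2 * ((hA.eigenvalues i + g k) * (hA.eigenvalues j + g k))⁻¹ := by
      rw [div_mul_div_comm, div_eq_mul_inv, sq]
    have hpos (k : Fin n) : 0 < ((hA.eigenvalues i + g k) * (hA.eigenvalues j + g k))⁻¹ := by
      have := hg k
      positivity
    apply Finset.sum_pos'
    · intro k _
      rw [hterm]
      exact mul_nonneg (sq_nonneg _) (hpos k).le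
    · refine ⟨k, Finset.mem_univ _, ?_⟩
      rw [hterm]
      exact mul_pos (sq_pos_iff.mpr hk) (hpos k)
  have hSne : (S : ℂ) ≠ 0 := by exact_mod_cast hSpos.ne'
  exact mul_ne_zero hSne (mul_ne_zero (star_ne_zero.mpr hai) haj) hsum

theorem sum_eigenvalues_outerR_sub_diagonal {n : ℕ} {x g : Fin n → ℝ}
    (hx : ∑ i, x i ^ 2 = 1) (hg1 : ∑ i, g i = 1)
    (hA : (outerR x - diagonal fun i => (g i : ℂ)).IsHermitian) :
    ∑ i, hA.eigenvalues i = 0 := by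
  have h := hA.trace_eq_sum_eigenvalues
  have h2 : (outerR x - diagonal fun i => (g i : ℂ)).trace
      = ((∑ i, x i ^ 2 - ∑ i, g i : ℝ) : ℂ) := by
    simp [Matrix.trace, outerR, outer, sq]
  rw [h2, hx, hg1, sub_self] at h
  have h3 : ((∑ i, hA.eigenvalues i : ℝ) : ℂ) = 0 := by
    rw [Complex.ofReal_sum]
    exact h.symm.trans Complex.ofReal_zero
  exact_mod_cast h3

/-- A real family with sum zero, all entries at most `t ≥ 0` and at most one positive entry has
`ℓ¹`-norm at most `2 t`. -/
theorem sum_abs_le_of_pos_unique {ι : Type*} [Fintype ι] {a : ι → ℝ} {t : ℝ}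
    (ht : 0 ≤ t) (hsum : ∑ i, a i = 0) (hle : ∀ i, a i ≤ t)
    (huniq : ∀ i j, 0 < a i → 0 < a j → i = j) : ∑ i, |a i| ≤ 2 * t := by
  classical
  by_cases h : ∃ i, 0 < a i
  · obtain ⟨i, hi⟩ := h
    have hneg : ∀ j ∈ Finset.univ.erase i, |a j| = -a j := by
      intro j hj
      apply abs_of_nonpos
      by_contra! hpos
      exact Finset.ne_of_mem_erase hj (huniq j i hpos hi)
    rw [← Finset.add_sum_erase _ _ (Finset.mem_univ i)] at hsum ⊢
    rw [Finset.sum_congr rfl hneg, Finset.sum_neg_distrib, abs_of_pos hi]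
    linarith [hle i]
  · push Not at h
    rw [Finset.sum_congr rfl fun i _ => abs_of_nonpos (h i), Finset.sum_neg_distrib, hsum]
    linarith

theorem two_mul_abs_le_sum_abs {ι : Type*} [Fintype ι] {a : ι → ℝ}
    (hsum : ∑ i, a i = 0) (i : ι) : 2 * |a i| ≤ ∑ j, |a j| := by
  classical
  rw [← Finset.add_sum_erase _ _ (Finset.mem_univ i)] at hsum ⊢
  have h1 : |a i| = |∑ j ∈ Finset.univ.erase i, a j| := by
    rw [← abs_neg, neg_eq_of_add_eq_zero_right hsum]
  have h2 := Finset.abs_sum_le_sum_abs a (Finset.univ.erase i)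
  linarith

/-- If all eigenvalues of `A` are at most `t` then `t • 1 - A` is positive semidefinite. -/
theorem posSemidef_smul_one_sub {n : ℕ} {A : Matrix (Fin n) (Fin n) ℂ} (hA : A.IsHermitian)
    {t : ℝ} (h : ∀ i, hA.eigenvalues i ≤ t) :
    ((t : ℂ) • (1 : Matrix (Fin n) (Fin n) ℂ) - A).PosSemidef := by
  have hU : (hA.eigenvectorUnitary : Matrix (Fin n) (Fin n) ℂ)
      * (hA.eigenvectorUnitary : Matrix (Fin n) (Fin n) ℂ)ᴴ = 1 :=
    Unitary.coe_mul_star_self hA.eigenvectorUnitary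
  have hs : A = (hA.eigenvectorUnitary : Matrix (Fin n) (Fin n) ℂ)
      * diagonal (fun i => (hA.eigenvalues i : ℂ))
      * (hA.eigenvectorUnitary : Matrix (Fin n) (Fin n) ℂ)ᴴ := by
    conv_lhs => rw [hA.spectral_theorem]
    rfl
  have hd : (diagonal fun i => ((t - hA.eigenvalues i : ℝ) : ℂ)).PosSemidef := by
    rw [posSemidef_diagonal_iff]
    intro i
    exact_mod_cast sub_nonneg.mpr (h i)
  have hP := hd.mul_mul_conjTranspose_same (hA.eigenvectorUnitary : Matrix (Fin n) (Fin n) ℂ)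
  convert hP using 1
  have hsplit : (diagonal fun i => ((t - hA.eigenvalues i : ℝ) : ℂ))
      = (t : ℂ) • (1 : Matrix (Fin n) (Fin n) ℂ)
        - diagonal (fun i => (hA.eigenvalues i : ℂ)) := by
    rw [smul_one_eq_diagonal, diagonal_sub]
    congr 1
    funext i
    push_cast
    rfl
  rw [hsplit, Matrix.mul_sub, Matrix.sub_mul, ← hs, Matrix.mul_smul, Matrix.mul_one,
    Matrix.smul_mul, hU]

/-! ### Certificates of optimality -/

/-- A dual certificate `w` for the optimality of `diag d` with optimal value `t`. -/
structure IsCertificate {n : ℕ} (x d w : Fin n → ℝ) (t c : ℝ) : Prop where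
  c_pos : 0 < c
  t_nonneg : 0 ≤ t
  d_nonneg : ∀ i, 0 ≤ d i
  d_sum : ∑ i, d i = 1
  w_nonneg : ∀ i, 0 ≤ w i
  w_le_one : ∀ i, w i ≤ 1
  x_nonneg : ∀ i, 0 ≤ x i
  overlap : ∑ i, x i * w i = c
  stationary : ∀ i, (d i + t) * w i = c * x i
  slack : ∀ i, d i = 0 ∨ w i = 1

theorem IsCertificate.x_ne_zero {n : ℕ} {x d w : Fin n → ℝ} {t c : ℝ}
    (h : IsCertificate x d w t c) : x ≠ 0 := by
  rintro rfl
  have := h.overlap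
  simp at this
  exact h.c_pos.ne this

theorem IsCertificate.eigenvalues_le {n : ℕ} {x d w : Fin n → ℝ} {t c : ℝ}
    (h : IsCertificate x d w t c)
    (hA : (outerR x - diagonal fun i => (d i : ℂ)).IsHermitian) (i : Fin n) :
    hA.eigenvalues i ≤ t := by
  by_contra! hlt
  have hl : 0 < hA.eigenvalues i := h.t_nonneg.trans_lt hlt
  have hne : (hA.eigenvectorBasis i).ofLp ≠ 0 := by
    intro h0
    exact hA.eigenvectorBasis.toBasis.ne_zero i (by
      rw [OrthonormalBasis.coe_toBasis]
      ext l
      exact congrFun h0 l)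
  have hsec := secular_equation h.d_nonneg hl hne (hA.mulVec_eigenvectorBasis i)
  set l := hA.eigenvalues i
  have hterm (j : Fin n) : c * (x j * (x j / (l + d j))) = x j * w j
      - x j * w j * ((l - t) / (l + d j)) := by
    have hpos : l + d j ≠ 0 := by linarith [h.d_nonneg j]
    field_simp
    linear_combination (-x j) * h.stationary j
  have hsum : ∑ j, x j * w j * ((l - t) / (l + d j)) = 0 := by
    have h1 : c * ∑ j, x j * (x j / (l + d j)) = ∑ j, x j * w j
        - ∑ j, x j * w j * ((l - t) / (l + d j)) := by
      rw [Finset.mul_sum, ← Finset.sum_sub_distrib]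
      exact Finset.sum_congr rfl fun j _ => hterm j
    rw [hsec, h.overlap] at h1
    linarith
  have hfac (j : Fin n) : 0 < (l - t) / (l + d j) :=
    div_pos (by linarith) (by linarith [h.d_nonneg j])
  have hz : ∀ j, x j * w j = 0 := by
    intro j
    have := (Finset.sum_eq_zero_iff_of_nonneg (fun j _ =>
      mul_nonneg (mul_nonneg (h.x_nonneg j) (h.w_nonneg j)) (hfac j).le)).mp hsum j
      (Finset.mem_univ j)
    exact (mul_eq_zero.mp this).resolve_right (hfac j).ne'
  have := h.overlap
  rw [Finset.sum_congr rfl fun j _ => hz j, Finset.sum_const_zero] at this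
  exact h.c_pos.ne this

theorem IsCertificate.unique {n : ℕ} {x d w : Fin n → ℝ} {t c : ℝ}
    (h : IsCertificate x d w t c) {g : Fin n → ℝ} (hg : ∀ i, 0 ≤ g i) (hg1 : ∑ i, g i = 1)
    (hA : (outerR x - diagonal fun i => (g i : ℂ)).IsHermitian)
    (hle : ∀ i, hA.eigenvalues i ≤ t) : g = d := by
  have hP := posSemidef_smul_one_sub hA hle
  set M := (t : ℂ) • (1 : Matrix (Fin n) (Fin n) ℂ) - (outerR x - diagonal fun i => (g i : ℂ))
  set v : Fin n → ℂ := fun i => (w i : ℂ) with hv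
  have hMv (i : Fin n) : (M *ᵥ v) i = (((t + g i) * w i - x i * c : ℝ) : ℂ) := by
    have h2 : (outerR x *ᵥ v) i = x i * ((∑ j, x j * w j : ℝ) : ℂ) := by
      simp [outerR, outer, mulVec, dotProduct, Finset.mul_sum, mul_assoc, hv]
    simp only [M]
    rw [Matrix.sub_mulVec, Matrix.sub_mulVec, Pi.sub_apply, Pi.sub_apply, mulVec_diagonal, h2,
      Matrix.smul_mulVec, Matrix.one_mulVec, Pi.smul_apply, h.overlap, hv]
    simp only [smul_eq_mul]
    push_cast
    ring
  have hquad : star v ⬝ᵥ M *ᵥ v = ((∑ i, w i * ((t + g i) * w i - x i * c) : ℝ) : ℂ) := by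
    rw [dotProduct, Complex.ofReal_sum]
    refine Finset.sum_congr rfl fun i _ => ?_
    rw [hMv, Complex.ofReal_mul]
    simp [hv]
  have hnn : 0 ≤ ∑ i, w i * ((t + g i) * w i - x i * c) := by
    have := hP.dotProduct_mulVec_nonneg v
    rw [hquad] at this
    exact_mod_cast this
  have hd : ∑ i, d i * w i ^ 2 = 1 := by
    rw [← h.d_sum]
    refine Finset.sum_congr rfl fun i _ => ?_
    rcases h.slack i with h0 | h0 <;> simp [h0]
  have hgw : ∑ i, g i * w i ^ 2 ≤ 1 := by
    rw [← hg1]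
    refine Finset.sum_le_sum fun i _ => ?_
    exact mul_le_of_le_one_right (hg i) (pow_le_one₀ (h.w_nonneg i) (h.w_le_one i))
  have heq : ∑ i, w i * ((t + g i) * w i - x i * c)
      = ∑ i, g i * w i ^ 2 - ∑ i, d i * w i ^ 2 := by
    rw [← Finset.sum_sub_distrib]
    refine Finset.sum_congr rfl fun i _ => ?_
    linear_combination w i * h.stationary i
  have hzero : ∑ i, w i * ((t + g i) * w i - x i * c) = 0 :=
    le_antisymm (by linarith) hnn
  have hker : M *ᵥ v = 0 := by
    rw [← hP.dotProduct_mulVec_zero_iff, hquad, hzero, Complex.ofReal_zero]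
  have hcomp (i : Fin n) : (g i - d i) * w i = 0 := by
    have h1 := hMv i
    rw [hker, Pi.zero_apply] at h1
    have h2 : (t + g i) * w i - x i * c = 0 := by exact_mod_cast h1.symm
    linear_combination h2 - h.stationary i
  have hdg (i : Fin n) : d i ≤ g i := by
    rcases mul_eq_zero.mp (hcomp i) with h0 | h0
    · linarith
    · rcases h.slack i with h1 | h1
      · rw [h1]; exact hg i
      · rw [h0] at h1; exact absurd h1 zero_ne_one
  funext i
  exact ((Finset.sum_eq_sum_iff_of_le fun i _ => hdg i).mp (h.d_sum.trans hg1.symm) i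
    (Finset.mem_univ i)).symm

theorem isIncoherent_diagonal {n : ℕ} {g : Fin n → ℝ} (hg : ∀ i, 0 ≤ g i)
    (hg1 : ∑ i, g i = 1) : IsIncoherent (diagonal fun i => (g i : ℂ)) := by
  refine ⟨⟨?_, ?_⟩, fun i j hij => diagonal_apply_ne _ hij⟩
  · rw [posSemidef_diagonal_iff]
    intro i
    exact_mod_cast hg i
  · rw [trace_diagonal]
    exact_mod_cast hg1

theorem IsIncoherent.exists_eq_diagonal_s9 {n : ℕ} {A : Matrix (Fin n) (Fin n) ℂ}
    (hA : IsIncoherent A) :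
    ∃ g : Fin n → ℝ, (∀ i, 0 ≤ g i) ∧ ∑ i, g i = 1 ∧ A = diagonal fun i => (g i : ℂ) := by
  obtain ⟨⟨hpsd, htr⟩, hoff⟩ := hA
  have hdiag (i : Fin n) : A i i = ((A i i).re : ℂ) :=
    Complex.eq_re_of_ofReal_le (by
      rw [Complex.ofReal_zero]
      exact hpsd.diag_nonneg)
  refine ⟨fun i => (A i i).re, fun i => ?_, ?_, ?_⟩
  · exact (Complex.le_def.mp (hpsd.diag_nonneg (i := i))).1
  · have := congrArg Complex.re htr
    simpa [Matrix.trace] using this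
  · ext i j
    by_cases hij : i = j
    · subst hij
      rw [diagonal_apply_eq]
      exact hdiag i
    · rw [diagonal_apply_ne _ hij, hoff i j hij]

theorem IsCertificate.eq_of_minimal {n : ℕ} {x d w : Fin n → ℝ} {t c : ℝ}
    (h : IsCertificate x d w t c) (hx : ∑ i, x i ^ 2 = 1)
    {δ : Matrix (Fin n) (Fin n) ℂ} (hδ : IsIncoherent δ)
    (hmin : traceNorm (outerR x - δ) ≤ traceNorm (outerR x - diagonal fun i => (d i : ℂ)) ∨
      opNorm (outerR x - δ) ≤ opNorm (outerR x - diagonal fun i => (d i : ℂ))) :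
    δ = diagonal fun i => (d i : ℂ) := by
  obtain ⟨g, hg, hg1, rfl⟩ := hδ.exists_eq_diagonal_s9
  have hA := isHermitian_outerR_sub_diagonal x g
  have hD := isHermitian_outerR_sub_diagonal x d
  have hAs := sum_eigenvalues_outerR_sub_diagonal hx hg1 hA
  have hDs := sum_eigenvalues_outerR_sub_diagonal hx h.d_sum hD
  have hDabs : ∑ i, |hD.eigenvalues i| ≤ 2 * t :=
    sum_abs_le_of_pos_unique h.t_nonneg hDs (h.eigenvalues_le hD)
      fun i j hi hj => eigenvalues_pos_unique h.x_ne_zero h.d_nonneg hD hi hj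
  have hle : ∀ i, hA.eigenvalues i ≤ t := by
    intro i
    rcases hmin with hm | hm
    · rw [traceNorm, traceNorm, dif_pos hA, dif_pos hD] at hm
      linarith [two_mul_abs_le_sum_abs hAs i, le_abs_self (hA.eigenvalues i)]
    · rw [opNorm, opNorm, dif_pos hA, dif_pos hD] at hm
      have h1 : |hA.eigenvalues i| ≤ ⨆ i, |hA.eigenvalues i| :=
        le_ciSup (f := fun i => |hA.eigenvalues i|) (Set.finite_range _).bddAbove i
      have h2 : ⨆ i, |hD.eigenvalues i| ≤ t :=
        Real.iSup_le (fun j => by linarith [two_mul_abs_le_sum_abs hDs j]) h.t_nonneg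
      linarith [le_abs_self (hA.eigenvalues i)]
  rw [h.unique hg hg1 hA hle]

theorem sum_Icc_ent {n : ℕ} (x : Fin n → ℝ) (f : ℝ → ℝ) {a b : ℕ} (ha : 1 ≤ a) (hb : b ≤ n) :
    ∑ j ∈ Finset.Icc a b, f (ent x j)
      = ∑ i : Fin n, if a ≤ (i : ℕ) + 1 ∧ (i : ℕ) + 1 ≤ b then f (x i) else 0 := by
  rw [← Finset.sum_filter]
  symm
  refine Finset.sum_bij (fun i _ => (i : ℕ) + 1) ?_ ?_ ?_ ?_
  · intro i hi
    simpa using hi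
  · intro i _ j _ hij
    ext
    simpa using hij
  · intro j hj
    rw [Finset.mem_Icc] at hj
    refine ⟨⟨j - 1, by omega⟩, ?_, ?_⟩
    · simp only [Finset.mem_filter, Finset.mem_univ, true_and]
      omega
    · simp only
      omega
  · intro i _
    rw [ent_succ]

theorem sVal_eq_sum {n : ℕ} (x : Fin n → ℝ) {k : ℕ} (hk : k ≤ n) :
    sVal x k = ∑ i : Fin n, if (i : ℕ) + 1 ≤ k then x i else 0 := by
  have h := sum_Icc_ent x id le_rfl hk
  simpa [sVal] using h

theorem mVal_eq_sum {n : ℕ} (x : Fin n → ℝ) (k : ℕ) :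
    mVal x k = ∑ i : Fin n, if (i : ℕ) + 1 ≤ k then 0 else x i ^ 2 := by
  rw [mVal, sum_Icc_ent x (· ^ 2) (by omega) le_rfl]
  refine Finset.sum_congr rfl fun i _ => ?_
  by_cases h : (i : ℕ) + 1 ≤ k
  · rw [if_neg (by omega), if_pos h]
  · rw [if_pos (by omega), if_neg h]

theorem mVal_nonneg {n : ℕ} (x : Fin n → ℝ) (k : ℕ) : 0 ≤ mVal x k :=
  Finset.sum_nonneg fun _ _ => sq_nonneg _

theorem sVal_succ {n : ℕ} (x : Fin n → ℝ) (k : ℕ) :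
    sVal x (k + 1) = sVal x k + ent x (k + 1) := by
  rw [sVal, sVal, Finset.sum_Icc_succ_top (by omega)]

theorem mVal_succ {n : ℕ} (x : Fin n → ℝ) {k : ℕ} (hk : k + 1 ≤ n) :
    mVal x k = ent x (k + 1) ^ 2 + mVal x (k + 1) := by
  rw [mVal, mVal, ← Finset.insert_Icc_add_one_left_eq_Icc hk,
    Finset.sum_insert (by simp)]

section qVal

variable {n : ℕ} {x : Fin n → ℝ} {k : ℕ}

theorem discrim_nonneg (x : Fin n → ℝ) (k : ℕ) :
    0 ≤ (pVal x k) ^ 2 + 4 * k * mVal x k * (sVal x k) ^ 2 := by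
  have := mVal_nonneg x k
  positivity

theorem abs_pVal_le_sqrt (x : Fin n → ℝ) (k : ℕ) :
    |pVal x k| ≤ Real.sqrt ((pVal x k) ^ 2 + 4 * k * mVal x k * (sVal x k) ^ 2) := by
  apply Real.abs_le_sqrt
  have := mVal_nonneg x k
  have : 0 ≤ 4 * k * mVal x k * (sVal x k) ^ 2 := by positivity
  linarith

theorem two_mul_qVal (hk : 1 ≤ k) (hs : 0 < sVal x k) :
    2 * k * sVal x k * qVal x k
      = pVal x k + Real.sqrt ((pVal x k) ^ 2 + 4 * k * mVal x k * (sVal x k) ^ 2) := by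
  have hk' : (0 : ℝ) < k := by exact_mod_cast hk
  rw [qVal, mul_div_cancel₀]
  positivity

theorem qVal_nonneg (hk : 1 ≤ k) (hs : 0 < sVal x k) : 0 ≤ qVal x k := by
  have hk' : (0 : ℝ) < k := by exact_mod_cast hk
  have h := two_mul_qVal hk hs
  have h2 := abs_pVal_le_sqrt x k
  have h3 : 0 ≤ 2 * k * sVal x k * qVal x k := by
    rw [h]
    linarith [neg_abs_le (pVal x k)]
  exact nonneg_of_mul_nonneg_right h3 (by positivity)

/-- `q_k` is a root of the quadratic `(s - k q) (s q + m) = q`. -/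
theorem qVal_root (hk : 1 ≤ k) (hs : 0 < sVal x k) :
    (sVal x k - k * qVal x k) * (sVal x k * qVal x k + mVal x k) = qVal x k := by
  have hk' : (0 : ℝ) < k := by exact_mod_cast hk
  have h := two_mul_qVal hk hs
  have h2 := Real.sq_sqrt (discrim_nonneg x k)
  rw [← sub_eq_of_eq_add' h] at h2
  have hp : pVal x k = sVal x k ^ 2 - 1 - k * mVal x k := rfl
  have h3 : (4 * k * sVal x k) * ((sVal x k - k * qVal x k) * (sVal x k * qVal x k + mVal x k))
      = (4 * k * sVal x k) * qVal x k := by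
    rw [hp] at h2
    linear_combination -h2
  exact mul_left_cancel₀ (by positivity) h3

/-- For `y ≥ 0`, `y ≤ q_k` implies that the quadratic defining `q_k` is nonnegative at `y`. -/
theorem quadratic_nonneg_of_le_qVal (hk : 1 ≤ k) (hs : 0 < sVal x k) {y : ℝ} (hy : 0 ≤ y)
    (hyq : y ≤ qVal x k) : y ≤ (sVal x k - k * y) * (sVal x k * y + mVal x k) := by
  have hk' : (0 : ℝ) < k := by exact_mod_cast hk
  have h := two_mul_qVal hk hs
  have h2 := abs_pVal_le_sqrt x k
  have h4 : 2 * k * sVal x k * y ≤ 2 * k * sVal x k * qVal x k := by gcongr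
  have h5 : 0 ≤ 2 * k * sVal x k * y := by positivity
  have h6 : (2 * k * sVal x k * y - pVal x k) ^ 2
      ≤ (pVal x k) ^ 2 + 4 * k * mVal x k * (sVal x k) ^ 2 := by
    rw [← Real.sq_sqrt (discrim_nonneg x k)]
    apply sq_le_sq'
    · linarith [le_abs_self (pVal x k)]
    · linarith
  have hp : pVal x k = sVal x k ^ 2 - 1 - k * mVal x k := rfl
  have h7 : (4 * k * sVal x k) * y
      ≤ (4 * k * sVal x k) * ((sVal x k - k * y) * (sVal x k * y + mVal x k)) := by
    rw [hp] at h6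
    linarith
  exact le_of_mul_le_mul_left h7 (by positivity)

theorem le_qVal_of_quadratic_nonneg (hk : 1 ≤ k) (hs : 0 < sVal x k) {y : ℝ}
    (h : y ≤ (sVal x k - k * y) * (sVal x k * y + mVal x k)) : y ≤ qVal x k := by
  have hk' : (0 : ℝ) < k := by exact_mod_cast hk
  have hp : pVal x k = sVal x k ^ 2 - 1 - k * mVal x k := rfl
  have h7 : (4 * k * sVal x k) * y
      ≤ (4 * k * sVal x k) * ((sVal x k - k * y) * (sVal x k * y + mVal x k)) := by gcongr
  have h6 : (2 * k * sVal x k * y - pVal x k) ^ 2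
      ≤ (pVal x k) ^ 2 + 4 * k * mVal x k * (sVal x k) ^ 2 := by
    rw [hp]
    linarith
  have h8 := (le_abs_self _).trans (Real.abs_le_sqrt h6)
  have h9 : 2 * k * sVal x k * y ≤ 2 * k * sVal x k * qVal x k := by
    rw [two_mul_qVal hk hs]
    linarith
  exact le_of_mul_le_mul_left h9 (by positivity)

/-- The quadratics for `k` and `k + 1` agree at `x_{k+1}`. -/
theorem ent_succ_le_qVal (hk : 1 ≤ k) (hkn : k + 1 ≤ n) (hs : 0 < sVal x k)
    (hx : 0 ≤ ent x (k + 1)) (h : ent x (k + 1) ≤ qVal x (k + 1)) :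
    ent x (k + 1) ≤ qVal x k := by
  apply le_qVal_of_quadratic_nonneg hk hs
  have hs' : 0 < sVal x (k + 1) := by rw [sVal_succ]; linarith
  have h1 := quadratic_nonneg_of_le_qVal (by omega) hs' hx h
  rw [sVal_succ] at h1
  have h2 := mVal_succ x hkn
  rw [h2]
  push_cast at h1
  linarith

end qVal

theorem sum_sq_le_sq_sum_of_nonneg {ι : Type*} [Fintype ι] {a : ι → ℝ} (ha : ∀ i, 0 ≤ a i) :
    ∑ i, a i ^ 2 ≤ (∑ i, a i) ^ 2 := by
  rw [sq (∑ i, a i), Finset.sum_mul]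
  refine Finset.sum_le_sum fun i hi => ?_
  rw [sq]
  exact mul_le_mul_of_nonneg_left (Finset.single_le_sum (fun j _ => ha j) hi) (ha i)

/-- The secular sum at `q_k`, with the convention `m / 0 = 0`. -/
theorem sVal_add_mVal_div_qVal {n : ℕ} {x : Fin n → ℝ} (hunit : ∑ j, x j ^ 2 = 1)
    (hnonneg : ∀ j, 0 ≤ x j) {k : ℕ} (hk : 1 ≤ k) (hkn : k ≤ n) (hs : 0 < sVal x k) :
    (sVal x k - k * qVal x k) * (sVal x k + mVal x k / qVal x k) = 1 := by
  have hroot := qVal_root hk hs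
  rcases eq_or_ne (qVal x k) 0 with h0 | h0
  · have h2 := two_mul_qVal hk hs
    rw [h0] at hroot h2 ⊢
    have hm : mVal x k = 0 := by
      have : sVal x k * mVal x k = 0 := by linear_combination hroot
      exact (mul_eq_zero.mp this).resolve_left hs.ne'
    have hp : pVal x k ≤ 0 := by
      have := Real.sqrt_nonneg ((pVal x k) ^ 2 + 4 * k * mVal x k * (sVal x k) ^ 2)
      linarith
    rw [pVal, hm] at hp
    have hsq : 1 ≤ sVal x k ^ 2 := by
      have h3 : ∑ i : Fin n, (if (i : ℕ) + 1 ≤ k then x i else 0) ^ 2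
          = ∑ i, x i ^ 2 - mVal x k := by
        rw [mVal_eq_sum, ← Finset.sum_sub_distrib]
        refine Finset.sum_congr rfl fun i _ => ?_
        split_ifs <;> simp
      rw [hunit, hm, sub_zero] at h3
      rw [sVal_eq_sum x hkn, ← h3]
      apply sum_sq_le_sq_sum_of_nonneg
      intro i
      split_ifs
      · exact hnonneg i
      · exact le_rfl
    rw [div_zero]
    linarith
  · field_simp
    linear_combination hroot

theorem isCertificate_qVal {n : ℕ} {x : Fin n → ℝ} (hunit : ∑ j, x j ^ 2 = 1)
    (hmono : ∀ i j : Fin n, i ≤ j → x j ≤ x i) (hnonneg : ∀ j, 0 ≤ x j)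
    {k : ℕ} (hk : k ∈ Finset.Icc 1 n) (hkq : qVal x k < ent x k)
    (hkmax : ∀ ℓ ∈ Finset.Icc 1 n, qVal x ℓ < ent x ℓ → ℓ ≤ k) :
    IsCertificate x
      (fun i : Fin n => if (i : ℕ) + 1 ≤ k then (x i - qVal x k) / (sVal x k - k * qVal x k) else 0)
      (fun i : Fin n => if (i : ℕ) + 1 ≤ k then 1 else x i / qVal x k)
      (qVal x k / (sVal x k - k * qVal x k)) (1 / (sVal x k - k * qVal x k)) := by
  obtain ⟨hk1, hkn⟩ := Finset.mem_Icc.mp hk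
  have hent : ent x k = x ⟨k - 1, by omega⟩ := by rw [ent, dif_pos ⟨hk1, hkn⟩]
  have hhead (i : Fin n) (hi : (i : ℕ) + 1 ≤ k) : qVal x k < x i := by
    refine hkq.trans_le ?_
    rw [hent]
    exact hmono _ _ (by rw [Fin.le_def]; simp only; omega)
  have hs : 0 < sVal x k := by
    by_contra! hle
    have hz : ∀ i : Fin n, x i = 0 := by
      have hnn : ∀ i ∈ Finset.univ, 0 ≤ (if (i : Fin n).val + 1 ≤ k then x i else 0) := by
        intro i _
        split_ifs
        · exact hnonneg i
        · exact le_rfl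
      rw [sVal_eq_sum x hkn] at hle
      have h0 := (Finset.sum_eq_zero_iff_of_nonneg hnn).mp (le_antisymm hle
        (Finset.sum_nonneg hnn)) ⟨0, by omega⟩ (Finset.mem_univ _)
      rw [if_pos (by simpa using hk1)] at h0
      intro i
      exact le_antisymm (h0 ▸ hmono ⟨0, by omega⟩ i (by simp [Fin.le_def])) (hnonneg i)
    simp [hz] at hunit
  have hq := qVal_nonneg hk1 hs
  have hcount : (k : ℝ) = ∑ i : Fin n, if (i : ℕ) + 1 ≤ k then (1 : ℝ) else 0 := by
    have h := sum_Icc_ent x (fun _ => 1) le_rfl hkn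
    simp at h
    simpa using h
  have hgap : sVal x k - k * qVal x k
      = ∑ i : Fin n, if (i : ℕ) + 1 ≤ k then x i - qVal x k else 0 := by
    rw [sVal_eq_sum x hkn]
    conv_lhs => enter [2, 1]; rw [hcount]
    rw [Finset.sum_mul, ← Finset.sum_sub_distrib]
    refine Finset.sum_congr rfl fun i _ => ?_
    split_ifs <;> simp
  have hpos : 0 < sVal x k - k * qVal x k := by
    rw [hgap]
    apply Finset.sum_pos'
    · intro i _
      split_ifs with h
      · linarith [hhead i h]
      · exact le_rfl
    · refine ⟨⟨0, by omega⟩, Finset.mem_univ _, ?_⟩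
      have h : ((⟨0, by omega⟩ : Fin n) : ℕ) + 1 ≤ k := by simpa using hk1
      rw [if_pos h]
      linarith [hhead _ h]
  have htail (i : Fin n) (hi : ¬ (i : ℕ) + 1 ≤ k) : x i ≤ qVal x k := by
    have hkn' : k + 1 ≤ n := by omega
    have hent' : ent x (k + 1) = x ⟨k, by omega⟩ := ent_succ x ⟨k, by omega⟩
    have h1 : x i ≤ ent x (k + 1) := by
      rw [hent']
      exact hmono _ _ (by rw [Fin.le_def]; simp only; omega)
    refine h1.trans (ent_succ_le_qVal hk1 hkn' hs (by rw [hent']; exact hnonneg _) ?_)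
    by_contra! hlt
    have := hkmax (k + 1) (Finset.mem_Icc.mpr ⟨by omega, hkn'⟩) hlt
    omega
  have hsec := sVal_add_mVal_div_qVal hunit hnonneg hk1 hkn hs
  constructor
  · positivity
  · positivity
  · intro i
    split_ifs with h
    · exact div_nonneg (by linarith [hhead i h]) hpos.le
    · exact le_rfl
  · rw [← div_self hpos.ne']
    conv_rhs => enter [1]; rw [hgap]
    rw [Finset.sum_div]
    refine Finset.sum_congr rfl fun i _ => ?_
    split_ifs <;> simp
  · intro i
    split_ifs
    · exact zero_le_one
    · exact div_nonneg (hnonneg i) hq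
  · intro i
    split_ifs with h
    · exact le_rfl
    · exact div_le_one_of_le₀ (htail i h) hq
  · exact hnonneg
  · rw [eq_div_iff hpos.ne', mul_comm]
    refine Eq.trans ?_ hsec
    congr 1
    rw [sVal_eq_sum x hkn, mVal_eq_sum, Finset.sum_div, ← Finset.sum_add_distrib]
    refine Finset.sum_congr rfl fun i _ => ?_
    split_ifs
    · simp
    · rw [zero_add]
      ring
  · intro i
    split_ifs with h
    · field_simp
      ring
    · rw [zero_add]
      rcases eq_or_ne (qVal x k) 0 with h0 | h0
      · have : x i = 0 := le_antisymm (h0 ▸ htail i h) (hnonneg i)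
        simp [this]
      · field_simp
  · intro i
    split_ifs
    · exact Or.inr rfl
    · exact Or.inl rfl

theorem DmatC_eq_diagonal {n : ℕ} (x : Fin n → ℝ) (k : ℕ) :
    DmatC x k = diagonal fun i : Fin n => ((if (i : ℕ) + 1 ≤ k then
      (x i - qVal x k) / (sVal x k - k * qVal x k) else 0 : ℝ) : ℂ) := by
  rw [DmatC]
  congr 1
  funext i
  rw [ent_succ]
  split_ifs <;> simp

/-- with `k` the maximal index with `x_k > q_k`, the state
`D = diag(d_1,…,d_k,0,…,0)`, `d_j = (x_j − q_k)/(s_k − k·q_k)`, is the UNIQUE incoherent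
state attaining `min_{δ incoherent} ‖|x⟩⟨x| − δ‖_tr`, and also the unique incoherent state
attaining `min_{δ incoherent} ‖|x⟩⟨x| − δ‖`. -/
theorem stmt9 {n : ℕ} (hn : 1 ≤ n) (x : Fin n → ℝ)
    (hunit : ∑ j, (x j) ^ 2 = 1)
    (hmono : ∀ i j : Fin n, i ≤ j → x j ≤ x i)
    (hnonneg : ∀ j, 0 ≤ x j)
    (k : ℕ) (hk : k ∈ Finset.Icc 1 n) (hkq : qVal x k < ent x k)
    (hkmax : ∀ ℓ ∈ Finset.Icc 1 n, qVal x ℓ < ent x ℓ → ℓ ≤ k) :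
    (∀ δ, IsIncoherent δ →
      (∀ δ', IsIncoherent δ' → traceNorm (outerR x - δ) ≤ traceNorm (outerR x - δ')) →
      δ = DmatC x k) ∧
    (∀ δ, IsIncoherent δ →
      (∀ δ', IsIncoherent δ' → opNorm (outerR x - δ) ≤ opNorm (outerR x - δ')) →
      δ = DmatC x k) := by
  have hcert := isCertificate_qVal hunit hmono hnonneg hk hkq hkmax
  have hD : IsIncoherent (DmatC x k) := by
    rw [DmatC_eq_diagonal]
    exact isIncoherent_diagonal hcert.d_nonneg hcert.d_sum
  constructor
  · intro δ hδ hmin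
    have h := hmin _ hD
    rw [DmatC_eq_diagonal] at h ⊢
    exact hcert.eq_of_minimal hunit hδ (Or.inl h)
  · intro δ hδ hmin
    have h := hmin _ hD
    rw [DmatC_eq_diagonal] at h ⊢
    exact hcert.eq_of_minimal hunit hδ (Or.inr h)
end

section
/- Let n ≥ 2 and let x = (x_1, …, x_n) be a real unit vector with x_1 ≥ x_2 ≥ … ≥ x_n ≥ 0. Then the unique incoherent state D attaining min_{δ incoherent} ‖|x⟩⟨x| − δ‖_tr has rank one — in which case it must equal diag(1, 0, …, 0) — if and only if x_1·m_2 ≥ 2·x_2·m_1, where m_1 = ∑_{j=2}^n x_j² and m_2 = ∑_{j=3}^n x_j². -/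
open Matrix BigOperators
open scoped ComplexOrder

lemma sum_abs_le_of_sum_eq_zero {ι : Type*} [Fintype ι] (μ : ι → ℝ) {t : ℝ} (ht : 0 ≤ t)
    (hsum : ∑ i, μ i = 0) (hle : ∀ i, μ i ≤ t)
    (hone : ∀ i k, i ≠ k → 0 < μ i → μ k ≤ 0) : ∑ i, |μ i| ≤ 2 * t := by
  have habs : ∀ i, |μ i| = 2 * max (μ i) 0 - μ i := by
    intro i
    rcases le_total 0 (μ i) with h | h
    · rw [abs_of_nonneg h, max_eq_left h]; ring
    · rw [abs_of_nonpos h, max_eq_right h]; ring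
  have hmax : ∑ i, max (μ i) 0 ≤ t := by
    by_cases hpos : ∃ i, 0 < μ i
    · obtain ⟨i, hi⟩ := hpos
      rw [Finset.sum_eq_single i (fun k _ hk => max_eq_right (hone i k hk.symm hi)) (by simp)]
      exact max_le (hle i) ht
    · push Not at hpos
      rw [Finset.sum_eq_zero fun i _ => max_eq_right (hpos i)]
      exact ht
  simp only [habs, Finset.sum_sub_distrib, ← Finset.mul_sum, hsum]
  linarith

lemma two_mul_le_sum_abs {ι : Type*} [Fintype ι] (μ : ι → ℝ) (hsum : ∑ i, μ i = 0) (i : ι) :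
    2 * μ i ≤ ∑ k, |μ k| := by
  classical
  have h1 := Finset.add_sum_erase Finset.univ μ (Finset.mem_univ i)
  have h2 := Finset.add_sum_erase Finset.univ (fun k => |μ k|) (Finset.mem_univ i)
  have h3 := Finset.abs_sum_le_sum_abs μ (Finset.univ.erase i)
  have h4 := le_abs_self (μ i)
  have h5 := neg_abs_le (∑ k ∈ Finset.univ.erase i, μ k)
  linarith

section Hermitian

variable {m : Type*} [Fintype m] [DecidableEq m] {A : Matrix m m ℂ}

lemma Matrix.IsHermitian.sum_eigenvalues_eq_zero (hA : A.IsHermitian) (htr : A.trace = 0) :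
    ∑ i, hA.eigenvalues i = 0 := by
  have h := hA.trace_eq_sum_eigenvalues
  rw [htr] at h
  simpa using (congrArg Complex.re h).symm

lemma posSemidef_smul_one_sub_of_traceNorm_le (hA : A.IsHermitian) (htr : A.trace = 0) {t : ℝ}
    (h : traceNorm A ≤ 2 * t) : ((t : ℂ) • (1 : Matrix m m ℂ) - A).PosSemidef := by
  rw [traceNorm, dif_pos hA] at h
  have hle : ∀ i, hA.eigenvalues i ≤ t := fun i => by
    linarith [two_mul_le_sum_abs _ (hA.sum_eigenvalues_eq_zero htr) i]
  have hd : (Matrix.diagonal fun i => ((t - hA.eigenvalues i : ℝ) : ℂ)).PosSemidef := by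
    rw [Matrix.posSemidef_diagonal_iff]
    intro i
    exact_mod_cast sub_nonneg.2 (hle i)
  have key := hd.mul_mul_conjTranspose_same (hA.eigenvectorUnitary : Matrix m m ℂ)
  convert key using 1
  conv_lhs => rw [hA.spectral_theorem]
  have hU : (hA.eigenvectorUnitary : Matrix m m ℂ) * (hA.eigenvectorUnitary : Matrix m m ℂ)ᴴ = 1 :=
    Unitary.coe_mul_star_self hA.eigenvectorUnitary
  have hdiag : (Matrix.diagonal fun i => ((t - hA.eigenvalues i : ℝ) : ℂ))
      = (t : ℂ) • (1 : Matrix m m ℂ) - Matrix.diagonal (RCLike.ofReal ∘ hA.eigenvalues) := by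
    ext i j
    by_cases hij : i = j
    · subst hij; simp
    · simp [hij]
  rw [hdiag, Matrix.mul_sub, Matrix.sub_mul, Unitary.conjStarAlgAut_apply]
  simp [hU, Matrix.star_eq_conjTranspose]

lemma eigenvalues_nonpos_of_forall_orthogonal (hA : A.IsHermitian) (y : m → ℂ)
    (hneg : ∀ w : m → ℂ, y ⬝ᵥ w = 0 → (star w ⬝ᵥ A *ᵥ w).re ≤ 0) {i k : m} (hik : i ≠ k)
    (hi : 0 < hA.eigenvalues i) : hA.eigenvalues k ≤ 0 := by
  set u : m → ℂ := (hA.eigenvectorBasis i).ofLp with hu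
  set v : m → ℂ := (hA.eigenvectorBasis k).ofLp with hv
  have hon := hA.eigenvectorBasis.orthonormal
  have ip : ∀ a b : m, star (hA.eigenvectorBasis a).ofLp ⬝ᵥ (hA.eigenvectorBasis b).ofLp
      = if a = b then 1 else 0 := by
    intro a b
    rw [dotProduct_comm, ← EuclideanSpace.inner_eq_star_dotProduct]
    exact orthonormal_iff_ite.1 hon a b
  have huu : star u ⬝ᵥ u = 1 := by rw [hu, ip]; simp
  have hvv : star v ⬝ᵥ v = 1 := by rw [hv, ip]; simp
  have huv : star u ⬝ᵥ v = 0 := by rw [hu, hv, ip]; simp [hik]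
  have hvu : star v ⬝ᵥ u = 0 := by rw [hu, hv, ip]; simp [hik.symm]
  have hAu : A *ᵥ u = (hA.eigenvalues i : ℂ) • u := by
    rw [hu, hA.mulVec_eigenvectorBasis]; ext; simp
  have hAv : A *ᵥ v = (hA.eigenvalues k : ℂ) • v := by
    rw [hv, hA.mulVec_eigenvectorBasis]; ext; simp
  by_contra! hk
  by_cases ha : y ⬝ᵥ v = 0
  · have := hneg v ha
    rw [hAv, dotProduct_smul, hvv] at this
    simp at this
    linarith
  · have horth : y ⬝ᵥ ((y ⬝ᵥ v) • u + (-(y ⬝ᵥ u)) • v) = 0 := by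
      rw [dotProduct_add, dotProduct_smul, dotProduct_smul, smul_eq_mul, smul_eq_mul]
      ring
    have := hneg _ horth
    generalize y ⬝ᵥ v = a at this ha
    generalize -(y ⬝ᵥ u) = b at this
    have hq : star (a • u + b • v) ⬝ᵥ A *ᵥ (a • u + b • v)
        = ((Complex.normSq a * hA.eigenvalues i + Complex.normSq b * hA.eigenvalues k : ℝ) : ℂ) := by
      rw [Matrix.mulVec_add, Matrix.mulVec_smul, Matrix.mulVec_smul, hAu, hAv]
      simp only [star_add, star_smul, add_dotProduct, dotProduct_add, smul_dotProduct,
        dotProduct_smul, huu, hvv, huv, hvu, smul_eq_mul, mul_one, mul_zero, add_zero, zero_add]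
      push_cast
      rw [Complex.normSq_eq_conj_mul_self, Complex.normSq_eq_conj_mul_self]
      simp only [RCLike.star_def]
      ring
    rw [hq, Complex.ofReal_re] at this
    have h1 := mul_pos (Complex.normSq_pos.2 ha) hi
    have h2 := mul_nonneg (Complex.normSq_nonneg b) hk.le
    linarith

lemma traceNorm_le_of_forall_re_le (hA : A.IsHermitian) (htr : A.trace = 0) (y : m → ℂ)
    (hneg : ∀ w : m → ℂ, y ⬝ᵥ w = 0 → (star w ⬝ᵥ A *ᵥ w).re ≤ 0) {t : ℝ} (ht : 0 ≤ t)
    (hle : ∀ w : m → ℂ, (star w ⬝ᵥ A *ᵥ w).re ≤ t * ∑ i, Complex.normSq (w i)) :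
    traceNorm A ≤ 2 * t := by
  rw [traceNorm, dif_pos hA]
  refine sum_abs_le_of_sum_eq_zero _ ht (hA.sum_eigenvalues_eq_zero htr) (fun i => ?_)
    (fun i k hik hi => eigenvalues_nonpos_of_forall_orthogonal hA y hneg hik hi)
  have h := hle (hA.eigenvectorBasis i).ofLp
  have hn : ∑ j, Complex.normSq ((hA.eigenvectorBasis i).ofLp j) = 1 := by
    have h1 := hA.eigenvectorBasis.orthonormal.1 i
    rw [EuclideanSpace.norm_eq, Real.sqrt_eq_one] at h1
    simpa [Complex.normSq_eq_norm_sq] using h1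
  rw [hn, mul_one] at h
  rw [hA.eigenvalues_eq]
  exact h

end Hermitian

section OuterSubDiagonal

variable {n : ℕ} (x d : Fin n → ℝ)

/-- The Hermitian matrix `|x⟩⟨x| - diag(d)`. -/
noncomputable def outerSubDiagonal : Matrix (Fin n) (Fin n) ℂ :=
  outerR x - Matrix.diagonal fun i => (d i : ℂ)

lemma outerSubDiagonal_isHermitian : (outerSubDiagonal x d).IsHermitian := by
  ext i j
  by_cases hij : i = j
  · subst hij; simp [outerSubDiagonal, outerR, outer]
  · simp [outerSubDiagonal, outerR, outer, hij, Ne.symm hij, mul_comm]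

variable {x d}

lemma trace_outerSubDiagonal (hx : ∑ i, x i ^ 2 = 1) (hd : ∑ i, d i = 1) :
    (outerSubDiagonal x d).trace = 0 := by
  have h : (outerSubDiagonal x d).trace = ((∑ i, x i ^ 2 - ∑ i, d i : ℝ) : ℂ) := by
    simp [outerSubDiagonal, outerR, outer, Matrix.trace, sq]
  rw [h, hx, hd]
  simp

variable (x d)

lemma outerSubDiagonal_mulVec (w : Fin n → ℂ) (i : Fin n) :
    (outerSubDiagonal x d *ᵥ w) i = x i * (∑ j, (x j : ℂ) * w j) - d i * w i := by
  rw [outerSubDiagonal, Matrix.sub_mulVec, Pi.sub_apply, Matrix.mulVec_diagonal]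
  simp [outerR, outer, Matrix.mulVec, dotProduct, Finset.mul_sum, mul_assoc]

lemma star_dotProduct_outerSubDiagonal_mulVec (w : Fin n → ℂ) :
    star w ⬝ᵥ outerSubDiagonal x d *ᵥ w
      = ((Complex.normSq (∑ j, (x j : ℂ) * w j) - ∑ i, d i * Complex.normSq (w i) : ℝ) : ℂ) := by
  simp only [dotProduct, outerSubDiagonal_mulVec, Pi.star_apply, mul_sub, Finset.sum_sub_distrib]
  push_cast
  congr 1
  · rw [Complex.normSq_eq_conj_mul_self, map_sum, Finset.sum_mul]
    refine Finset.sum_congr rfl fun i _ => ?_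
    simp
    ring
  · refine Finset.sum_congr rfl fun i _ => ?_
    rw [Complex.normSq_eq_conj_mul_self, RCLike.star_def]
    ring

variable {x d}

lemma normSq_sum_mul_le {c : Fin n → ℝ} (hc : ∀ i, 0 ≤ c i) (hcx : ∀ i, c i = 0 → x i = 0)
    (hle : ∑ i, x i ^ 2 / c i ≤ 1) (w : Fin n → ℂ) :
    Complex.normSq (∑ j, (x j : ℂ) * w j) ≤ ∑ i, c i * Complex.normSq (w i) := by
  have h1 : ‖∑ j, (x j : ℂ) * w j‖ ≤ ∑ j, |x j| * ‖w j‖ := by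
    refine (norm_sum_le _ _).trans_eq (Finset.sum_congr rfl fun i _ => ?_)
    simp
  have h2 : (∑ j, |x j| * ‖w j‖) ^ 2
      ≤ (∑ i, x i ^ 2 / c i) * ∑ i, c i * Complex.normSq (w i) := by
    refine Finset.sum_sq_le_sum_mul_sum_of_sq_le_mul _
      (fun i _ => div_nonneg (sq_nonneg _) (hc i))
      (fun i _ => mul_nonneg (hc i) (Complex.normSq_nonneg _)) fun i _ => le_of_eq ?_
    rw [mul_pow, sq_abs, Complex.normSq_eq_norm_sq]
    rcases eq_or_ne (c i) 0 with h | h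
    · simp [h, hcx i h]
    · field_simp
  have h3 : 0 ≤ ∑ i, c i * Complex.normSq (w i) :=
    Finset.sum_nonneg fun i _ => mul_nonneg (hc i) (Complex.normSq_nonneg _)
  rw [Complex.normSq_eq_norm_sq]
  calc ‖∑ j, (x j : ℂ) * w j‖ ^ 2 ≤ (∑ j, |x j| * ‖w j‖) ^ 2 := by gcongr
    _ ≤ _ := h2
    _ ≤ _ := mul_le_of_le_one_left h3 hle

lemma traceNorm_outerSubDiagonal_le (hx : ∑ i, x i ^ 2 = 1) (hd : ∑ i, d i = 1)
    (hd0 : ∀ i, 0 ≤ d i) {t : ℝ} (ht : 0 ≤ t) (htx : ∀ i, t + d i = 0 → x i = 0)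
    (hle : ∑ i, x i ^ 2 / (t + d i) ≤ 1) : traceNorm (outerSubDiagonal x d) ≤ 2 * t := by
  refine traceNorm_le_of_forall_re_le (outerSubDiagonal_isHermitian x d)
    (trace_outerSubDiagonal hx hd) (fun i => (x i : ℂ)) (fun w hw => ?_) ht fun w => ?_
  · rw [star_dotProduct_outerSubDiagonal_mulVec, Complex.ofReal_re]
    have h0 : ∑ j, (x j : ℂ) * w j = 0 := hw
    rw [h0, map_zero, zero_sub, neg_nonpos]
    exact Finset.sum_nonneg fun i _ => mul_nonneg (hd0 i) (Complex.normSq_nonneg _)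
  · rw [star_dotProduct_outerSubDiagonal_mulVec, Complex.ofReal_re]
    have h := normSq_sum_mul_le (fun i => add_nonneg ht (hd0 i)) htx hle w
    simp only [add_mul, Finset.sum_add_distrib, ← Finset.mul_sum] at h
    linarith

lemma star_dotProduct_smul_one_sub_outerSubDiagonal_mulVec (t : ℝ) (v : Fin n → ℝ) :
    (star fun i => (v i : ℂ)) ⬝ᵥ
        ((t : ℂ) • (1 : Matrix (Fin n) (Fin n) ℂ) - outerSubDiagonal x d) *ᵥ (fun i => (v i : ℂ))
      = ((t * ∑ i, v i ^ 2 + ∑ i, d i * v i ^ 2 - (∑ i, x i * v i) ^ 2 : ℝ) : ℂ) := by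
  rw [Matrix.sub_mulVec, Matrix.smul_mulVec, Matrix.one_mulVec, dotProduct_sub,
    star_dotProduct_outerSubDiagonal_mulVec, dotProduct_smul]
  have h : ∑ j, (x j : ℂ) * (v j : ℂ) = ((∑ j, x j * v j : ℝ) : ℂ) := by push_cast; rfl
  rw [h, Complex.normSq_ofReal]
  simp only [Complex.normSq_ofReal, dotProduct, Pi.star_apply, RCLike.star_def,
    Complex.conj_ofReal, smul_eq_mul]
  push_cast
  simp only [← sq]
  ring

lemma sq_sum_mul_le_of_traceNorm_le {t : ℝ} (hx : ∑ i, x i ^ 2 = 1) (hd : ∑ i, d i = 1)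
    (h : traceNorm (outerSubDiagonal x d) ≤ 2 * t) (v : Fin n → ℝ) :
    (∑ i, x i * v i) ^ 2 ≤ t * ∑ i, v i ^ 2 + ∑ i, d i * v i ^ 2 := by
  have hpsd := posSemidef_smul_one_sub_of_traceNorm_le (outerSubDiagonal_isHermitian x d)
    (trace_outerSubDiagonal hx hd) h
  have hre := hpsd.dotProduct_mulVec_nonneg fun i => (v i : ℂ)
  rw [star_dotProduct_smul_one_sub_outerSubDiagonal_mulVec, Complex.zero_le_real] at hre
  linarith

lemma mul_sum_eq_of_traceNorm_le {t : ℝ} (hx : ∑ i, x i ^ 2 = 1) (hd : ∑ i, d i = 1)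
    (h : traceNorm (outerSubDiagonal x d) ≤ 2 * t) {v : Fin n → ℝ}
    (heq : (∑ i, x i * v i) ^ 2 = t * ∑ i, v i ^ 2 + ∑ i, d i * v i ^ 2) (i : Fin n) :
    x i * ∑ j, x j * v j = (t + d i) * v i := by
  have hpsd := posSemidef_smul_one_sub_of_traceNorm_le (outerSubDiagonal_isHermitian x d)
    (trace_outerSubDiagonal hx hd) h
  have hker := congrFun ((hpsd.dotProduct_mulVec_zero_iff fun i => (v i : ℂ)).1 (by
    rw [star_dotProduct_smul_one_sub_outerSubDiagonal_mulVec, heq]; simp)) i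
  rw [Matrix.sub_mulVec, Pi.sub_apply, outerSubDiagonal_mulVec, Matrix.smul_mulVec,
    Matrix.one_mulVec, Pi.smul_apply, Pi.zero_apply, smul_eq_mul] at hker
  have hreal : t * v i - (x i * (∑ j, x j * v j) - d i * v i) = 0 := by exact_mod_cast hker
  linarith

/-- The eigenvector of `|x⟩⟨x| - |e_j⟩⟨e_j|` for its largest eigenvalue `l = √(1 - x_j²)`. -/
def singleEigenvector (x : Fin n → ℝ) (j : Fin n) (l : ℝ) (k : Fin n) : ℝ :=
  if k = j then l * x j else (1 + l) * x k

section SingleEigenvector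

variable {j : Fin n} {l : ℝ}

lemma sum_mul_singleEigenvector (hx : ∑ i, x i ^ 2 = 1) (hl : l ^ 2 = 1 - x j ^ 2) :
    ∑ k, x k * singleEigenvector x j l k = l + l ^ 2 := by
  have h : ∀ k, x k * singleEigenvector x j l k
      = (1 + l) * x k ^ 2 - if k = j then x j ^ 2 else 0 := by
    intro k
    unfold singleEigenvector
    split_ifs with hk
    · subst hk; ring
    · ring
  simp only [h, Finset.sum_sub_distrib, ← Finset.mul_sum, hx, Finset.sum_ite_eq',
    Finset.mem_univ, if_true]
  linarith

lemma sum_sq_singleEigenvector (hx : ∑ i, x i ^ 2 = 1) (hl : l ^ 2 = 1 - x j ^ 2) :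
    ∑ k, singleEigenvector x j l k ^ 2 = 2 * l ^ 2 * (1 + l) := by
  have h : ∀ k, singleEigenvector x j l k ^ 2
      = (1 + l) ^ 2 * x k ^ 2 - if k = j then (1 + 2 * l) * x j ^ 2 else 0 := by
    intro k
    unfold singleEigenvector
    split_ifs with hk
    · subst hk; ring
    · ring
  simp only [h, Finset.sum_sub_distrib, ← Finset.mul_sum, hx, Finset.sum_ite_eq',
    Finset.mem_univ, if_true]
  linear_combination (-1 - 2 * l) * hl

lemma singleEigenvector_self : singleEigenvector x j l j = l * x j := if_pos rfl

lemma singleEigenvector_of_ne {i : Fin n} (hij : i ≠ j) :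
    singleEigenvector x j l i = (1 + l) * x i := if_neg hij

end SingleEigenvector

lemma exists_perturbation_lt_one {a b l : ℝ} (hl : 0 < l) (ha : 0 ≤ a) (hla : l ^ 2 = 1 - a ^ 2)
    (hab : l * a < (1 + l) * b) :
    ∃ e t : ℝ, 0 < e ∧ e < 1 ∧ 0 < t ∧ t < l ∧
      a ^ 2 / (t + (1 - e)) + b ^ 2 / (t + e) + (l ^ 2 - b ^ 2) / t < 1 := by
  have hsq : a ^ 2 * (l * l) < b ^ 2 * ((l + 1) * (l + 1)) := by
    have := mul_self_lt_mul_self (by positivity) hab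
    nlinarith
  obtain ⟨e, he, he0, he1⟩ : ∃ e : ℝ,
      a ^ 2 * (l * (l + e)) < b ^ 2 * ((l + 1 - e) * (l + 1)) ∧ 0 < e ∧ e < 1 := by
    have hcont : ∀ᶠ e in nhds (0 : ℝ),
        a ^ 2 * (l * (l + e)) < b ^ 2 * ((l + 1 - e) * (l + 1)) := by
      refine ContinuousAt.eventually_lt (by fun_prop) (by fun_prop) ?_
      simpa using hsq
    have hlt : ∀ᶠ e in nhds (0 : ℝ), e < 1 := eventually_lt_nhds one_pos
    obtain ⟨e, ⟨h1, h2⟩, h3⟩ :=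
      (((hcont.and hlt).filter_mono nhdsWithin_le_nhds).and
        (self_mem_nhdsWithin (s := Set.Ioi (0 : ℝ)))).exists
    exact ⟨e, h1, h3, h2⟩
  have hlt1 : a ^ 2 / (l + (1 - e)) + b ^ 2 / (l + e) + (l ^ 2 - b ^ 2) / l < 1 := by
    have h1 : 0 < l + (1 - e) := by linarith
    have h2 : 0 < l + e := by linarith
    have key : a ^ 2 / (l + (1 - e)) + b ^ 2 / (l + e) + (l ^ 2 - b ^ 2) / l - 1
        = e * (a ^ 2 * (l * (l + e)) - b ^ 2 * ((l + 1 - e) * (l + 1)))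
          / ((l + (1 - e)) * (l + 1) * (l * (l + e))) := by
      have ha2 : a ^ 2 = 1 - l ^ 2 := by linarith
      rw [ha2]
      field_simp
      ring
    have : e * (a ^ 2 * (l * (l + e)) - b ^ 2 * ((l + 1 - e) * (l + 1)))
          / ((l + (1 - e)) * (l + 1) * (l * (l + e))) < 0 :=
      div_neg_of_neg_of_pos (mul_neg_of_pos_of_neg he0 (by linarith)) (by positivity)
    linarith
  have hcont : ∀ᶠ t in nhds l,
      a ^ 2 / (t + (1 - e)) + b ^ 2 / (t + e) + (l ^ 2 - b ^ 2) / t < 1 := by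
    have h1 : l + (1 - e) ≠ 0 := by linarith
    have h2 : l + e ≠ 0 := by linarith
    have h3 : l ≠ 0 := hl.ne'
    exact ContinuousAt.eventually_lt (by fun_prop (disch := assumption)) (by fun_prop) hlt1
  have hpos : ∀ᶠ t in nhds l, 0 < t := eventually_gt_nhds hl
  obtain ⟨t, ⟨h1, h2⟩, h3⟩ :=
    (((hcont.and hpos).filter_mono nhdsWithin_le_nhds).and
      (self_mem_nhdsWithin (s := Set.Iio l))).exists
  exact ⟨e, t, he0, he1, h2, h3, h1⟩

lemma sq_add_sq_le_one_of_ne (hx : ∑ i, x i ^ 2 = 1) {i j : Fin n} (hij : i ≠ j) :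
    x i ^ 2 + x j ^ 2 ≤ 1 := by
  rw [← hx, ← Finset.sum_pair (f := fun k => x k ^ 2) hij]
  exact Finset.sum_le_sum_of_subset_of_nonneg (Finset.subset_univ _) fun k _ _ => sq_nonneg (x k)

lemma one_add_mul_le_of_single_minimizer {j : Fin n} {l : ℝ} (hx : ∑ i, x i ^ 2 = 1)
    (hx0 : ∀ i, 0 ≤ x i) (hl0 : 0 ≤ l) (hl : l ^ 2 = 1 - x j ^ 2)
    (hmin : ∀ d : Fin n → ℝ, (∀ i, 0 ≤ d i) → ∑ i, d i = 1 →
      traceNorm (outerSubDiagonal x (Pi.single j 1)) ≤ traceNorm (outerSubDiagonal x d))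
    {i : Fin n} (hij : i ≠ j) : (1 + l) * x i ≤ l * x j := by
  by_contra! hlt
  have hle : x j ^ 2 + x i ^ 2 ≤ 1 :=
    sq_add_sq_le_one_of_ne hx hij.symm
  rcases hl0.eq_or_lt with rfl | hlpos
  · nlinarith [hx0 i]
  obtain ⟨e, t, he0, he1, ht0, htl, hsum⟩ := exists_perturbation_lt_one hlpos (hx0 j) hl hlt
  let d : Fin n → ℝ := fun k => (if k = j then 1 - e else 0) + if k = i then e else 0
  have hd0 : ∀ k, 0 ≤ d k := fun k => by
    simp only [d]
    split_ifs <;> linarith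
  have hd : ∑ k, d k = 1 := by simp [d, Finset.sum_add_distrib]
  have hdiv : ∑ k, x k ^ 2 / (t + d k) ≤ 1 := by
    have h : ∀ k, x k ^ 2 / (t + d k) = x k ^ 2 / t
        + (if k = j then x j ^ 2 / (t + (1 - e)) - x j ^ 2 / t else 0)
        + (if k = i then x i ^ 2 / (t + e) - x i ^ 2 / t else 0) := by
      intro k
      by_cases hkj : k = j
      · subst hkj; simp [d, hij.symm]
      · by_cases hki : k = i
        · subst hki; simp [d, hkj]
        · simp [d, hkj, hki]
    simp only [h, Finset.sum_add_distrib, ← Finset.sum_div, hx, Finset.sum_ite_eq',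
      Finset.mem_univ, if_true]
    rw [hl, sub_div, sub_div] at hsum
    linarith
  have hnorm := (hmin d hd0 hd).trans (traceNorm_outerSubDiagonal_le hx hd hd0 ht0.le
    (fun k hk => absurd hk (by linarith [hd0 k])) hdiv)
  have hq := sq_sum_mul_le_of_traceNorm_le hx (by simp) hnorm (singleEigenvector x j l)
  rw [sum_mul_singleEigenvector hx hl, sum_sq_singleEigenvector hx hl] at hq
  simp only [Pi.single_apply, ite_mul, one_mul, zero_mul, Finset.sum_ite_eq', Finset.mem_univ,
    if_true, singleEigenvector_self, mul_pow] at hq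
  have hxj : x j ^ 2 = 1 - l ^ 2 := by linarith
  rw [hxj] at hq
  have : 0 < (l - t) * (2 * l ^ 2 * (1 + l)) := mul_pos (by linarith) (by positivity)
  nlinarith

lemma traceNorm_outerSubDiagonal_single_le {j : Fin n} {l : ℝ} (hx : ∑ i, x i ^ 2 = 1)
    (hl0 : 0 ≤ l) (hl : l ^ 2 = 1 - x j ^ 2) :
    traceNorm (outerSubDiagonal x (Pi.single j 1)) ≤ 2 * l := by
  refine traceNorm_outerSubDiagonal_le hx (by simp) (fun i => ?_) hl0 (fun i hi => ?_) ?_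
  · simp only [Pi.single_apply]
    split_ifs <;> norm_num
  · rw [Pi.single_apply] at hi
    split_ifs at hi with hij
    · linarith
    · have hle : x j ^ 2 + x i ^ 2 ≤ 1 :=
        sq_add_sq_le_one_of_ne hx (Ne.symm hij)
      have : l = 0 := by linarith
      subst this
      have : x i ^ 2 ≤ 0 := by linarith
      exact pow_eq_zero_iff two_ne_zero |>.1 (le_antisymm this (sq_nonneg _))
  · have h : ∀ k, x k ^ 2 / (l + (Pi.single j 1 : Fin n → ℝ) k) = x k ^ 2 / l
        + (if k = j then x j ^ 2 / (l + 1) - x j ^ 2 / l else 0) := by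
      intro k
      by_cases hkj : k = j
      · subst hkj; simp
      · simp [hkj]
    simp only [h, Finset.sum_add_distrib, ← Finset.sum_div, hx, Finset.sum_ite_eq',
      Finset.mem_univ, if_true]
    have hxj : x j ^ 2 = 1 - l ^ 2 := by linarith
    rw [hxj]
    rcases hl0.eq_or_lt with rfl | hlpos
    · simp
    · apply le_of_eq
      field_simp
      ring

lemma eq_single_of_traceNorm_le {j : Fin n} {l : ℝ} (hx : ∑ i, x i ^ 2 = 1)
    (hx0 : ∀ i, 0 ≤ x i) (hl0 : 0 ≤ l) (hl : l ^ 2 = 1 - x j ^ 2)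
    (hle : ∀ i, i ≠ j → (1 + l) * x i ≤ l * x j) (hd0 : ∀ i, 0 ≤ d i) (hd : ∑ i, d i = 1)
    (hnorm : traceNorm (outerSubDiagonal x d) ≤ traceNorm (outerSubDiagonal x (Pi.single j 1))) :
    d = Pi.single j 1 := by
  have hnorm' := hnorm.trans (traceNorm_outerSubDiagonal_single_le hx hl0 hl)
  have hxj : x j ^ 2 = 1 - l ^ 2 := by linarith
  have hdj : 1 ≤ d j := by
    rcases hl0.eq_or_lt with rfl | hlpos
    · have h := sq_sum_mul_le_of_traceNorm_le hx hd hnorm' (Pi.single j 1)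
      simp [Pi.single_apply] at h
      linarith
    · have hv0 : ∀ i, 0 ≤ singleEigenvector x j l i := fun i => by
        unfold singleEigenvector
        split_ifs
        · exact mul_nonneg hl0 (hx0 j)
        · exact mul_nonneg (by linarith) (hx0 i)
      have hv : ∀ i, singleEigenvector x j l i ≤ l * x j := fun i => by
        unfold singleEigenvector
        split_ifs with hij
        · exact le_rfl
        · exact hle i hij
      have hsum : ∑ i, d i * singleEigenvector x j l i ^ 2 ≤ (l * x j) ^ 2 :=
        calc ∑ i, d i * singleEigenvector x j l i ^ 2 ≤ ∑ i, d i * (l * x j) ^ 2 :=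
              Finset.sum_le_sum fun i _ =>
                mul_le_mul_of_nonneg_left (pow_le_pow_left₀ (hv0 i) (hv i) 2) (hd0 i)
          _ = (l * x j) ^ 2 := by rw [← Finset.sum_mul, hd, one_mul]
      have hq := sq_sum_mul_le_of_traceNorm_le hx hd hnorm' (singleEigenvector x j l)
      have heq := mul_sum_eq_of_traceNorm_le hx hd hnorm' (le_antisymm hq (by
        rw [sum_mul_singleEigenvector hx hl, sum_sq_singleEigenvector hx hl]
        rw [mul_pow, hxj] at hsum
        nlinarith)) j
      rw [sum_mul_singleEigenvector hx hl, singleEigenvector_self] at heq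
      have hxpos : x j ≠ 0 := by
        intro h0
        have hall : ∀ i, x i = 0 := fun i => by
          by_cases hij : i = j
          · rw [hij, h0]
          · have := hle i hij
            rw [h0, mul_zero] at this
            nlinarith [hx0 i]
        simp [hall] at hx
      have : (l * x j) * (1 - d j) = 0 := by linear_combination heq
      rcases mul_eq_zero.1 this with h | h
      · exact absurd h (mul_ne_zero hlpos.ne' hxpos)
      · linarith
  have hsplit := Finset.add_sum_erase Finset.univ d (Finset.mem_univ j)
  have herase : ∑ i ∈ Finset.univ.erase j, d i = 0 :=
    le_antisymm (by linarith) (Finset.sum_nonneg fun i _ => hd0 i)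
  have hzero := (Finset.sum_eq_zero_iff_of_nonneg fun i _ => hd0 i).1 herase
  ext i
  by_cases hij : i = j
  · subst hij; simp; linarith
  · rw [Pi.single_eq_of_ne hij]
    exact hzero i (by simp [hij])

end OuterSubDiagonal

lemma one_add_mul_le_mul_iff {a b l : ℝ} (ha : 0 < a) (hb : 0 ≤ b) (hba : b ≤ a) (hl0 : 0 ≤ l)
    (hl : l ^ 2 = 1 - a ^ 2) :
    (1 + l) * b ≤ l * a ↔ 2 * b * l ^ 2 ≤ a * (l ^ 2 - b ^ 2) := by
  have h1 : (1 + l) * b ≤ l * a ↔ b ≤ l * (a - b) := by constructor <;> intro h <;> linarith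
  rw [h1, ← sq_le_sq₀ hb (mul_nonneg hl0 (sub_nonneg.2 hba)), ← sub_nonneg,
    ← sub_nonneg (a := a * _)]
  have h2 : (l * (a - b)) ^ 2 - b ^ 2 = a * (a * (l ^ 2 - b ^ 2) - 2 * b * l ^ 2) := by
    linear_combination b ^ 2 * hl
  rw [h2, mul_nonneg_iff_of_pos_left ha]

section Incoherent

variable {n : ℕ}

lemma isIncoherent_diagonal_ofReal {d : Fin n → ℝ} (hd0 : ∀ i, 0 ≤ d i) (hd : ∑ i, d i = 1) :
    IsIncoherent (Matrix.diagonal fun i => (d i : ℂ)) := by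
  refine ⟨⟨?_, ?_⟩, fun i j hij => Matrix.diagonal_apply_ne _ hij⟩
  · rw [Matrix.posSemidef_diagonal_iff]
    exact fun i => Complex.zero_le_real.2 (hd0 i)
  · rw [Matrix.trace_diagonal]
    exact_mod_cast hd

lemma IsIncoherent.exists_eq_diagonal_ofReal {D : Matrix (Fin n) (Fin n) ℂ}
    (hD : IsIncoherent D) :
    ∃ d : Fin n → ℝ, (∀ i, 0 ≤ d i) ∧ ∑ i, d i = 1 ∧ D = Matrix.diagonal fun i => (d i : ℂ) := by
  obtain ⟨⟨hpsd, htr⟩, hdiag⟩ := hD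
  have hnn : ∀ i, 0 ≤ D i i := fun i => hpsd.diag_nonneg
  have hre : ∀ i, ((D i i).re : ℂ) = D i i := fun i => (Complex.eq_re_of_ofReal_le (hnn i)).symm
  refine ⟨fun i => (D i i).re, fun i => (Complex.nonneg_iff.1 (hnn i)).1, ?_, ?_⟩
  · simpa [Matrix.trace] using congrArg Complex.re htr
  · ext i j
    by_cases hij : i = j
    · subst hij; simp [hre]
    · simp [hij, hdiag i j hij]

lemma rank_diagonal_ofReal_eq_one_iff {d : Fin n → ℝ} (hd : ∑ i, d i = 1) :
    (Matrix.diagonal fun i => (d i : ℂ)).rank = 1 ↔ ∃ j, d = Pi.single j 1 := by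
  classical
  rw [Matrix.rank_diagonal, Fintype.card_eq_one_iff]
  constructor
  · rintro ⟨⟨j, hj⟩, huniq⟩
    have hzero : ∀ i, i ≠ j → d i = 0 := fun i hij => by
      by_contra h
      exact hij (congrArg Subtype.val (huniq ⟨i, by exact_mod_cast h⟩))
    rw [Finset.sum_eq_single j (fun i _ => hzero i) (by simp)] at hd
    refine ⟨j, funext fun i => ?_⟩
    by_cases hij : i = j
    · subst hij; simp [hd]
    · rw [Pi.single_eq_of_ne hij, hzero i hij]
  · rintro ⟨j, rfl⟩
    refine ⟨⟨j, by simp⟩, fun ⟨i, hi⟩ => Subtype.ext ?_⟩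
    by_contra hij
    exact hi (by simp [Pi.single_eq_of_ne hij])

end Incoherent

lemma mVal_eq_ent_sq_add {n : ℕ} (x : Fin n → ℝ) {k : ℕ} (hk : k < n) :
    mVal x k = ent x (k + 1) ^ 2 + mVal x (k + 1) := by
  unfold mVal
  rw [← Finset.insert_Icc_add_one_left_eq_Icc (by omega : k + 1 ≤ n), Finset.sum_insert (by simp)]

lemma mVal_zero {n : ℕ} (x : Fin n → ℝ) : mVal x 0 = ∑ j, x j ^ 2 := by
  have h : ∀ j : Fin n, x j ^ 2 = ent x (1 + (j : ℕ)) ^ 2 := fun j => by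
    rw [ent, dif_pos ⟨by omega, by omega⟩]
    congr 3
    simp
  simp only [h]
  rw [Fin.sum_univ_eq_sum_range (fun k => ent x (1 + k) ^ 2), mVal, zero_add,
    ← Finset.Ico_add_one_right_eq_Icc, Finset.sum_Ico_eq_sum_range]
  simp

/-- for `n ≥ 2`, the unique incoherent state `D` attaining
`min_{δ incoherent} ‖|x⟩⟨x| − δ‖_tr` has rank one — in which case it equals
`diag(1,0,…,0)` — iff `x_1·m_2 ≥ 2·x_2·m_1`. -/
theorem stmt10 {n : ℕ} (hn : 2 ≤ n) (x : Fin n → ℝ)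
    (hunit : ∑ j, (x j) ^ 2 = 1)
    (hmono : ∀ i j : Fin n, i ≤ j → x j ≤ x i)
    (hnonneg : ∀ j, 0 ≤ x j)
    (D : Matrix (Fin n) (Fin n) ℂ) (hD : IsIncoherent D)
    (hmin : ∀ δ, IsIncoherent δ →
      traceNorm (outerR x - D) ≤ traceNorm (outerR x - δ)) :
    (D.rank = 1 ↔ ent x 1 * mVal x 2 ≥ 2 * ent x 2 * mVal x 1) ∧
    (D.rank = 1 → D = Matrix.diagonal fun i : Fin n => if (i : ℕ) = 0 then 1 else 0) := by
  have hn0 : 0 < n := by omega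
  set i0 : Fin n := ⟨0, hn0⟩ with hi0
  set i1 : Fin n := ⟨1, hn⟩ with hi1
  have he1 : ent x 1 = x i0 := by rw [ent, dif_pos ⟨le_rfl, hn0⟩]
  have he2 : ent x 2 = x i1 := by rw [ent, dif_pos ⟨by omega, hn⟩]
  have hm1 : mVal x 1 = 1 - x i0 ^ 2 := by
    have := mVal_eq_ent_sq_add x hn0
    rw [mVal_zero, hunit, zero_add, he1] at this
    linarith
  have hm2 : mVal x 2 = mVal x 1 - x i1 ^ 2 := by
    have := mVal_eq_ent_sq_add x (show 1 < n from hn)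
    rw [he2] at this
    linarith
  have hxle : ∀ j, x j ^ 2 ≤ 1 := fun j => by
    rw [← hunit]
    exact Finset.single_le_sum (f := fun j => x j ^ 2) (fun k _ => sq_nonneg (x k))
      (Finset.mem_univ j)
  have hle0 : ∀ j, x j ≤ x i0 := fun j => hmono i0 j (Nat.zero_le _)
  have hx0 : 0 < x i0 := by
    refine (hnonneg i0).lt_of_ne fun h => ?_
    have hall : ∀ j, x j = 0 := fun j => le_antisymm (h ▸ hle0 j) (hnonneg j)
    simp [hall] at hunit
  have hsqrt : ∀ j, √(1 - x j ^ 2) ^ 2 = 1 - x j ^ 2 := fun j =>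
    Real.sq_sqrt (sub_nonneg.2 (hxle j))
  have hcond : ent x 1 * mVal x 2 ≥ 2 * ent x 2 * mVal x 1 ↔
      (1 + √(1 - x i0 ^ 2)) * x i1 ≤ √(1 - x i0 ^ 2) * x i0 := by
    rw [one_add_mul_le_mul_iff hx0 (hnonneg i1) (hle0 i1) (Real.sqrt_nonneg _) (hsqrt i0),
      hsqrt, he1, he2, hm2, hm1]
  obtain ⟨d, hd0, hd, rfl⟩ := hD.exists_eq_diagonal_ofReal
  have hmin' : ∀ d' : Fin n → ℝ, (∀ i, 0 ≤ d' i) → ∑ i, d' i = 1 →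
      traceNorm (outerSubDiagonal x d) ≤ traceNorm (outerSubDiagonal x d') :=
    fun d' h0 h1 => hmin _ (isIncoherent_diagonal_ofReal h0 h1)
  have hsingle : ∀ j, d = Pi.single j 1 → j = i0 ∧
      (1 + √(1 - x i0 ^ 2)) * x i1 ≤ √(1 - x i0 ^ 2) * x i0 := by
    rintro j rfl
    have hall : ∀ i, i ≠ j → (1 + √(1 - x j ^ 2)) * x i ≤ √(1 - x j ^ 2) * x j :=
      fun i hij => one_add_mul_le_of_single_minimizer hunit hnonneg (Real.sqrt_nonneg _)
        (hsqrt j) hmin' hij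
    have hj : j = i0 := by
      by_contra hne
      nlinarith [hall i0 (Ne.symm hne),
        mul_le_mul_of_nonneg_left (hle0 j) (Real.sqrt_nonneg (1 - x j ^ 2))]
    subst hj
    exact ⟨rfl, hall i1 (by simp [hi0, hi1])⟩
  rw [rank_diagonal_ofReal_eq_one_iff hd, hcond]
  refine ⟨⟨fun ⟨j, hj⟩ => (hsingle j hj).2, fun h => ⟨i0, ?_⟩⟩, fun ⟨j, hj⟩ => ?_⟩
  · refine eq_single_of_traceNorm_le hunit hnonneg (Real.sqrt_nonneg _) (hsqrt i0)
      (fun i hi => ?_) hd0 hd (hmin' _ (fun i => ?_) (by simp))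
    · have hi1i : i1 ≤ i := by
        rw [Fin.le_def]
        exact Nat.one_le_iff_ne_zero.2 fun h0 => hi (Fin.ext h0)
      refine (mul_le_mul_of_nonneg_left (hmono i1 i hi1i) ?_).trans h
      positivity
    · rw [Pi.single_apply]
      split_ifs <;> norm_num
  · rw [hj, (hsingle j hj).1]
    congr 1
    ext i
    rw [Pi.single_apply]
    simp only [hi0, Fin.ext_iff]
    split_ifs <;> simp
end
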